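/- arXiv:2211.14600 — 4 statements merged into one kernel-verified Lean document; each statement's English description precedes it below -/
import Mathlib

section
/- Let C and D be coherent categories, M : C ⥤ D a coherent functor, and (A_x ≤ M x)_{x ∈ C} a family of subobjects (one for each object of C). The following are equivalent: (1) the family satisfies the Tarski–Vaught criterion and preserves finite products; (2) the family extends to an elementary coherent subfunctor of M, i.e. there exist a coherent functor N : C ⥤ D and an elementary natural transformation α : N ⟶ M each of whose components is a monomorphism representing the subobject A_x of M x, and this extension is unique as a subobject of M in the functor category D^C. -/
open CategoryTheory CategoryTheory.Limits

universe w v u v' u'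

namespace PosModel

variable {C : Type u} [Category.{v} C] {D : Type u'} [Category.{v'} D]

/-- A natural transformation is *elementary* if each naturality square at a
monomorphism is a pullback square. -/
def Elementary {N M : C ⥤ D} (η : N ⟶ M) : Prop :=
  ∀ ⦃a x : C⦄ (i : a ⟶ x), Mono i →
    IsPullback (N.map i) (η.app a) (η.app x) (M.map i)

/-- A functor preserves monomorphisms (formulated explicitly). -/
def PreservesMono (F : C ⥤ D) : Prop :=
  ∀ ⦃X Y : C⦄ (f : X ⟶ Y), Mono f → Mono (F.map f)

/-- The subobject represented by a monomorphism (with an explicit proof of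
monicity). -/
noncomputable def mkSub {X A : C} (f : A ⟶ X) (h : Mono f) : Subobject X :=
  haveI := h
  Subobject.mk f

/-- The image of a subobject under a mono-preserving functor. -/
noncomputable def mapSub (F : C ⥤ D) (h : PreservesMono F) {X : C} (a : Subobject X) :
    Subobject (F.obj X) :=
  mkSub (F.map a.arrow) (h a.arrow inferInstance)

/-- The subobject of a functor `M` represented by a pointwise-mono natural
transformation. -/
noncomputable def natSub {N M : C ⥤ D} (α : N ⟶ M) (h : ∀ x : C, Mono (α.app x)) :
    Subobject M :=
  haveI : ∀ x : C, Mono (α.app x) := h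
  haveI : Mono α := NatTrans.mono_of_mono_app α
  Subobject.mk α

/-- The axioms of a *coherent category*: a finitely complete category with
(pullback-stable) effective epi–mono factorizations, binary unions of
subobjects and a least subobject of every object, both stable under pullback. -/
structure CoherentData (C : Type u) [Category.{v} C] [HasFiniteLimits C] :
    Type (max u v) where
  sup : ∀ {X : C}, Subobject X → Subobject X → Subobject X
  le_sup_left : ∀ {X : C} (a b : Subobject X), a ≤ sup a b
  le_sup_right : ∀ {X : C} (a b : Subobject X), b ≤ sup a b
  sup_le : ∀ {X : C} {a b c : Subobject X}, a ≤ c → b ≤ c → sup a b ≤ c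
  bot : ∀ X : C, Subobject X
  bot_le : ∀ {X : C} (a : Subobject X), bot X ≤ a
  factor : ∀ {X Y : C} (f : X ⟶ Y), ∃ (Z : C) (e : X ⟶ Z) (m : Z ⟶ Y),
    EffectiveEpi e ∧ Mono m ∧ e ≫ m = f
  effectiveEpi_pullback : ∀ {P X Y Z : C} (fst : P ⟶ X) (snd : P ⟶ Y) (f : X ⟶ Z) (g : Y ⟶ Z),
    IsPullback fst snd f g → EffectiveEpi g → EffectiveEpi fst
  sup_pullback : ∀ {X Y : C} (f : X ⟶ Y) (a b : Subobject Y),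
    (Subobject.pullback f).obj (sup a b) =
      sup ((Subobject.pullback f).obj a) ((Subobject.pullback f).obj b)
  bot_pullback : ∀ {X Y : C} (f : X ⟶ Y),
    (Subobject.pullback f).obj (bot Y) = bot X

/-- The image of a subobject along an arbitrary morphism, computed using the
effective epi–mono factorizations of a coherent category. -/
noncomputable def CoherentData.img {C : Type u} [Category.{v} C] [HasFiniteLimits C]
    (hC : CoherentData C) {X Y : C} (f : X ⟶ Y) (a : Subobject X) : Subobject Y :=
  mkSub (hC.factor ((a.arrow : (a : C) ⟶ X) ≫ f)).choose_spec.choose_spec.choose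
    (hC.factor ((a.arrow : (a : C) ⟶ X) ≫ f)).choose_spec.choose_spec.choose_spec.2.1

/-- A functor between coherent categories is *coherent* if it preserves finite
limits, effective epimorphisms, finite unions of subobjects and the least
subobjects. -/
structure IsCoherent {C : Type u} [Category.{v} C] {D : Type u'} [Category.{v'} D]
    [HasFiniteLimits C] [HasFiniteLimits D]
    (hC : CoherentData C) (hD : CoherentData D) (F : C ⥤ D) : Prop where
  presLim : Nonempty (PreservesFiniteLimits F)
  presMono : PreservesMono F
  presEpi : ∀ ⦃X Y : C⦄ (f : X ⟶ Y), EffectiveEpi f → EffectiveEpi (F.map f)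
  map_sup : ∀ {X : C} (a b : Subobject X),
    mapSub F presMono (hC.sup a b) = hD.sup (mapSub F presMono a) (mapSub F presMono b)
  map_bot : ∀ X : C, mapSub F presMono (hC.bot X) = hD.bot (F.obj X)

/-- Two functors are *elementarily equivalent* if they validate the same
inclusions of subobjects. -/
def ElemEquiv [HasFiniteLimits C] [HasFiniteLimits D] (M N : C ⥤ D)
    (hM : PreservesMono M) (hN : PreservesMono N) : Prop :=
  ∀ (x : C) (a b : Subobject x),
    (mapSub M hM a ≤ mapSub M hM b) ↔ (mapSub N hN a ≤ mapSub N hN b)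

/-- Membership of an element in a subobject of a set. -/
def memSub {X : Type w} (S : Subobject X) (a : X) : Prop :=
  ∃ b : (S : Type w), S.arrow b = a

/-- The Tarski–Vaught criterion for a family of subobjects `A x ≤ M x`. -/
def TarskiVaught {C : Type u} [Category.{v} C] {D : Type u'} [Category.{v'} D]
    [HasFiniteLimits C] [HasFiniteLimits D] (hD : CoherentData D)
    (M : C ⥤ D) (hM : PreservesMono M) (A : ∀ x : C, Subobject (M.obj x)) : Prop :=
  ∀ (x y : C) (φ : Subobject (x ⨯ y)),
    hD.img (M.map (prod.snd : x ⨯ y ⟶ y))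
        ((mapSub M hM φ ⊓
            (Subobject.pullback (M.map (prod.snd : x ⨯ y ⟶ y))).obj (A y)) ⊓
          (Subobject.pullback (M.map (prod.fst : x ⨯ y ⟶ x))).obj (A x)) =
      hD.img (M.map (prod.snd : x ⨯ y ⟶ y))
        (mapSub M hM φ ⊓
          (Subobject.pullback (M.map (prod.snd : x ⨯ y ⟶ y))).obj (A y))

/-- The family of subobjects `A x ≤ M x` preserves finite products. -/
def PreservesProdsFam {C : Type u} [Category.{v} C] {D : Type u'} [Category.{v'} D]
    [HasFiniteLimits C] [HasFiniteLimits D]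
    (M : C ⥤ D) (A : ∀ x : C, Subobject (M.obj x)) : Prop :=
  A (⊤_ C) = ⊤ ∧
  ∀ x y : C, A (x ⨯ y) =
    (Subobject.pullback (M.map (prod.fst : x ⨯ y ⟶ x))).obj (A x) ⊓
      (Subobject.pullback (M.map (prod.snd : x ⨯ y ⟶ y))).obj (A y)

/-- The family of subobjects `A x ≤ M x` extends, uniquely as a subobject of `M`
in the functor category `D^C`, to an elementary coherent subfunctor of `M`. -/
def ExtendsToElementarySubfunctor {C : Type u} [Category.{v} C] {D : Type u'} [Category.{v'} D]
    [HasFiniteLimits C] [HasFiniteLimits D]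
    (hC : CoherentData C) (hD : CoherentData D)
    (M : C ⥤ D) (A : ∀ x : C, Subobject (M.obj x)) : Prop :=
  ∃ (N : C ⥤ D) (_ : IsCoherent hC hD N) (α : N ⟶ M) (hm : ∀ x : C, Mono (α.app x)),
    Elementary α ∧ (∀ x : C, mkSub (α.app x) (hm x) = A x) ∧
    ∀ (N' : C ⥤ D) (_ : IsCoherent hC hD N') (α' : N' ⟶ M) (hm' : ∀ x : C, Mono (α'.app x)),
      Elementary α' → (∀ x : C, mkSub (α'.app x) (hm' x) = A x) →
        natSub α hm = natSub α' hm'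

section

theorem mkSub_factors_iff {X A Z : C} (f : A ⟶ X) (h : Mono f) (g : Z ⟶ X) :
    (mkSub f h).Factors g ↔ ∃ k, k ≫ f = g :=
  Iff.rfl

theorem mapSub_factors_iff (F : C ⥤ D) (h : PreservesMono F) {X : C} (a : Subobject X) {Z : D}
    (g : Z ⟶ F.obj X) : (mapSub F h a).Factors g ↔ ∃ k, k ≫ F.map a.arrow = g :=
  mkSub_factors_iff _ _ _

theorem mapSub_mk_factors_iff (F : C ⥤ D) (h : PreservesMono F) {X W : C} (j : W ⟶ X) [Mono j]
    {Z : D} (g : Z ⟶ F.obj X) :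
    (mapSub F h (Subobject.mk j)).Factors g ↔ ∃ k, k ≫ F.map j = g := by
  rw [mapSub_factors_iff]
  constructor
  · rintro ⟨k, rfl⟩
    exact ⟨k ≫ F.map (Subobject.underlyingIso j).hom, by
      rw [Category.assoc, ← F.map_comp, Subobject.underlyingIso_hom_comp_eq_mk]⟩
  · rintro ⟨k, rfl⟩
    exact ⟨k ≫ F.map (Subobject.underlyingIso j).inv, by
      rw [Category.assoc, ← F.map_comp, Subobject.underlyingIso_arrow]⟩

theorem subobject_le_iff_factors {X : C} {a b : Subobject X} :
    a ≤ b ↔ ∀ ⦃Z : C⦄ (h : Z ⟶ X), a.Factors h → b.Factors h :=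
  ⟨fun hab _ h ha ↦ Subobject.factors_of_le h hab ha,
    fun H ↦ Subobject.le_of_factors (H _ (Subobject.factors_self a))⟩

theorem factors_of_effectiveEpi_comp {X Z W : C} (b : Subobject X) (e : W ⟶ Z) [EffectiveEpi e]
    (h : Z ⟶ X) (H : b.Factors (e ≫ h)) : b.Factors h := by
  have sq : CommSq (b.factorThru _ H) e b.arrow h := ⟨by simp⟩
  rw [← sq.fac_right]
  exact Subobject.factors_comp_arrow _

/-- Any morphism into the target of an effective epimorphism `f` lifts along `f` after
precomposition with some effective epimorphism. -/
theorem CoherentData.exists_effectiveEpi_lift [HasFiniteLimits C] (hC : CoherentData C)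
    {X Y Z : C} (f : X ⟶ Y) [EffectiveEpi f] (h : Z ⟶ Y) :
    ∃ (W : C) (e : W ⟶ Z) (k : W ⟶ X), EffectiveEpi e ∧ k ≫ f = e ≫ h :=
  ⟨_, pullback.fst h f, pullback.snd h f,
    hC.effectiveEpi_pullback _ _ _ _ (IsPullback.of_hasPullback h f) inferInstance,
    pullback.condition.symm⟩

theorem CoherentData.img_factors_iff [HasFiniteLimits C] (hC : CoherentData C) {X Y Z : C}
    (f : X ⟶ Y) (a : Subobject X) (h : Z ⟶ Y) :
    (hC.img f a).Factors h ↔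
      ∃ (W : C) (e : W ⟶ Z) (k : W ⟶ X), EffectiveEpi e ∧ a.Factors k ∧ k ≫ f = e ≫ h := by
  set s := (hC.factor (a.arrow ≫ f)).choose_spec.choose_spec
  have hepi : EffectiveEpi (hC.factor (a.arrow ≫ f)).choose_spec.choose := s.choose_spec.1
  have hfac : (hC.factor (a.arrow ≫ f)).choose_spec.choose ≫ s.choose = a.arrow ≫ f :=
    s.choose_spec.2.2
  constructor
  · rintro ⟨g, rfl⟩
    obtain ⟨W, e, k, he, hk⟩ := hC.exists_effectiveEpi_lift
      (hC.factor (a.arrow ≫ f)).choose_spec.choose g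
    refine ⟨W, e, k ≫ a.arrow, he, Subobject.factors_comp_arrow _, ?_⟩
    exact (Category.assoc _ _ _).trans ((congrArg (k ≫ ·) hfac.symm).trans
      ((Category.assoc _ _ _).symm.trans ((congrArg (· ≫ s.choose) hk).trans
        (Category.assoc _ _ _))))
  · rintro ⟨W, e, k, he, hk, hke⟩
    refine factors_of_effectiveEpi_comp _ e h ?_
    rw [← hke]
    refine (mkSub_factors_iff _ _ _).2
      ⟨a.factorThru k hk ≫ (hC.factor (a.arrow ≫ f)).choose_spec.choose, ?_⟩
    rw [Category.assoc, hfac, Subobject.factorThru_arrow_assoc]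

/-- A transformation `α : N ⟶ M` with monic components reflects preservation of a limit from `M`
to `N` as soon as a morphism into `M` of the limit lifts along `α` when its projections do. -/
theorem preservesLimit_of_mono_app {J : Type*} [Category* J] {N M : C ⥤ D} (α : N ⟶ M)
    (hm : ∀ x, Mono (α.app x)) {K : J ⥤ C} {c : Cone K} (hc : IsLimit c) [PreservesLimit K M]
    (H : ∀ ⦃Z : D⦄ (g : Z ⟶ M.obj c.pt),
      (∀ j, ∃ u, u ≫ α.app (K.obj j) = g ≫ M.map (c.π.app j)) → ∃ u, u ≫ α.app c.pt = g) :
    PreservesLimit K N := by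
  refine preservesLimit_of_preserves_limit_cone hc ?_
  let t (s : Cone (K ⋙ N)) : Cone (K ⋙ M) :=
    (Cone.postcompose (Functor.whiskerLeft K α)).obj s
  have hM := isLimitOfPreserves M hc
  have key (s : Cone (K ⋙ N)) : ∃ u : s.pt ⟶ N.obj c.pt, u ≫ α.app c.pt = hM.lift (t s) :=
    H _ fun j ↦ ⟨s.π.app j, (hM.fac (t s) j).symm⟩
  choose l hl using key
  have fac (s : Cone (K ⋙ N)) (j : J) : l s ≫ N.map (c.π.app j) = s.π.app j := by
    have := hm (K.obj j)
    rw [← cancel_mono (α.app (K.obj j)), Category.assoc, α.naturality, ← Category.assoc, hl]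
    exact hM.fac (t s) j
  refine ⟨l, fac, fun s m hmj ↦ ?_⟩
  have := hm c.pt
  rw [← cancel_mono (α.app c.pt), hl]
  refine hM.uniq (t s) _ fun j ↦ ?_
  have h1 : m ≫ N.map (c.π.app j) = s.π.app j := hmj j
  change (m ≫ α.app c.pt) ≫ M.map (c.π.app j) = s.π.app j ≫ α.app (K.obj j)
  rw [← h1, Category.assoc, Category.assoc, α.naturality]

/-- The subfunctor of `M` on a family of subobjects that is closed under the action of `M`. -/
noncomputable def subfunctor (M : C ⥤ D) (A : ∀ x : C, Subobject (M.obj x))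
    (h : ∀ ⦃x y : C⦄ (f : x ⟶ y), (A y).Factors ((A x).arrow ≫ M.map f)) : C ⥤ D where
  obj x := (A x : D)
  map f := (A _).factorThru _ (h f)
  map_id x := by
    rw [← cancel_mono (A x).arrow]
    simp
  map_comp {x y z} f g := by
    rw [← cancel_mono (A z).arrow]
    simp

/-- The inclusion of `subfunctor M A h` into `M`. -/
noncomputable def subfunctorι (M : C ⥤ D) (A : ∀ x : C, Subobject (M.obj x))
    (h : ∀ ⦃x y : C⦄ (f : x ⟶ y), (A y).Factors ((A x).arrow ≫ M.map f)) :
    subfunctor M A h ⟶ M where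
  app x := (A x).arrow
  naturality _ _ f := Subobject.factorThru_arrow _ _ (h f)

theorem natSub_le_of_mkSub_le {N N' M : C ⥤ D} (α : N ⟶ M) (α' : N' ⟶ M)
    (hm : ∀ x, Mono (α.app x)) (hm' : ∀ x, Mono (α'.app x))
    (h : ∀ x, mkSub (α.app x) (hm x) ≤ mkSub (α'.app x) (hm' x)) :
    natSub α hm ≤ natSub α' hm' := by
  have key (x : C) : ∃ u, u ≫ α'.app x = α.app x :=
    (mkSub_factors_iff _ (hm' x) _).1 (Subobject.factors_of_le _ (h x)
      ((mkSub_factors_iff _ (hm x) _).2 ⟨𝟙 _, Category.id_comp _⟩))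
  choose u hu using key
  let β : N ⟶ N' :=
    { app := u
      naturality := fun x y f ↦ by
        have := hm' y
        rw [← cancel_mono (α'.app y)]
        simp [hu, reassoc_of% hu] }
  have : Mono α := NatTrans.mono_of_mono_app α
  have : Mono α' := NatTrans.mono_of_mono_app α'
  exact Subobject.mk_le_mk_of_comm β (by ext x; exact hu x)

theorem natSub_eq_of_mkSub_eq {N N' M : C ⥤ D} (α : N ⟶ M) (α' : N' ⟶ M)
    (hm : ∀ x, Mono (α.app x)) (hm' : ∀ x, Mono (α'.app x))
    (h : ∀ x, mkSub (α.app x) (hm x) = mkSub (α'.app x) (hm' x)) :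
    natSub α hm = natSub α' hm' :=
  le_antisymm (natSub_le_of_mkSub_le _ _ _ _ fun x ↦ (h x).le)
    (natSub_le_of_mkSub_le _ _ _ _ fun x ↦ (h x).ge)

theorem factors_iff_of_mkSub_eq {X B Z : D} {A : Subobject X} {i : B ⟶ X} {hi : Mono i}
    (h : mkSub i hi = A) (g : Z ⟶ X) : A.Factors g ↔ ∃ u, u ≫ i = g := by
  rw [← h, mkSub_factors_iff]

theorem Elementary.mapSub_eq_pullback [HasFiniteLimits D] {N M : C ⥤ D} {α : N ⟶ M}
    (hel : Elementary α) (hN : PreservesMono N) (hM : PreservesMono M) {x : C}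
    (a : Subobject x) :
    mapSub N hN a = (Subobject.pullback (α.app x)).obj (mapSub M hM a) := by
  have := hN a.arrow inferInstance
  have := hM a.arrow inferInstance
  exact (Subobject.pullback_obj_mk (hel a.arrow inferInstance).flip).symm

variable [HasFiniteLimits C] [HasFiniteLimits D] {hC : CoherentData C} {hD : CoherentData D}
  {M : C ⥤ D}

namespace TarskiVaught

variable {hM : PreservesMono M} {A : ∀ x : C, Subobject (M.obj x)}

/-- The Tarski–Vaught criterion, applied to a subobject `(f, g) : w ⟶ x ⨯ y`, in terms of
generalized elements. -/
theorem exists_witness (hTV : TarskiVaught hD M hM A) {w x y : C} (f : w ⟶ x) (g : w ⟶ y)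
    [Mono (prod.lift f g)] {Z : D} (h : Z ⟶ M.obj w) (hh : (A y).Factors (h ≫ M.map g)) :
    ∃ (W : D) (e : W ⟶ Z) (t : W ⟶ M.obj w), EffectiveEpi e ∧
      t ≫ M.map g = e ≫ h ≫ M.map g ∧ (A x).Factors (t ≫ M.map f) := by
  have h1 : (hD.img (M.map (prod.snd : x ⨯ y ⟶ y)) (mapSub M hM (Subobject.mk (prod.lift f g)) ⊓
      (Subobject.pullback (M.map (prod.snd : x ⨯ y ⟶ y))).obj (A y))).Factors (h ≫ M.map g) := by
    rw [CoherentData.img_factors_iff]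
    refine ⟨Z, 𝟙 Z, h ≫ M.map (prod.lift f g), inferInstance, ?_, ?_⟩
    · rw [Subobject.inf_factors, pullback_factors_iff, mapSub_mk_factors_iff]
      refine ⟨⟨h, rfl⟩, ?_⟩
      rwa [Category.assoc, ← M.map_comp, prod.lift_snd]
    · rw [Category.assoc, ← M.map_comp, prod.lift_snd, Category.id_comp]
  rw [← hTV, CoherentData.img_factors_iff] at h1
  obtain ⟨W, e, k, he, hk, hke⟩ := h1
  rw [Subobject.inf_factors, Subobject.inf_factors, pullback_factors_iff,
    pullback_factors_iff, mapSub_mk_factors_iff] at hk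
  obtain ⟨⟨⟨t, rfl⟩, -⟩, hk⟩ := hk
  refine ⟨W, e, t, he, ?_, ?_⟩
  · rwa [Category.assoc, ← M.map_comp, prod.lift_snd] at hke
  · rwa [Category.assoc, ← M.map_comp, prod.lift_fst] at hk

theorem factors_map (hTV : TarskiVaught hD M hM A) {x y : C} (f : x ⟶ y) {Z : D}
    {h : Z ⟶ M.obj x} (hh : (A x).Factors h) : (A y).Factors (h ≫ M.map f) := by
  obtain ⟨W, e, t, he, ht, ht'⟩ := hTV.exists_witness f (𝟙 x) h (by simpa using hh)
  simp only [CategoryTheory.Functor.map_id, Category.comp_id] at ht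
  rw [ht, Category.assoc] at ht'
  exact factors_of_effectiveEpi_comp _ e _ ht'

theorem factors_of_factors_map (hTV : TarskiVaught hD M hM A) {a x : C} (i : a ⟶ x) [Mono i]
    {Z : D} {h : Z ⟶ M.obj a} (hh : (A x).Factors (h ≫ M.map i)) : (A a).Factors h := by
  obtain ⟨W, e, t, he, ht, ht'⟩ := hTV.exists_witness (𝟙 a) i h hh
  have := hM i inferInstance
  rw [← Category.assoc, cancel_mono] at ht
  rw [ht, M.map_id, Category.comp_id] at ht'
  exact factors_of_effectiveEpi_comp _ e _ ht'

variable {N : C ⥤ D} (α : N ⟶ M) (hm : ∀ x, Mono (α.app x))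

theorem elementary_of_mkSub_eq (hTV : TarskiVaught hD M hM A)
    (hsub : ∀ x, mkSub (α.app x) (hm x) = A x) : Elementary α := by
  intro a x i hi
  have key (s : PullbackCone (α.app x) (M.map i)) : ∃ l, l ≫ α.app a = s.snd :=
    (factors_iff_of_mkSub_eq (hsub a) _).1 (hTV.factors_of_factors_map i
      ((factors_iff_of_mkSub_eq (hsub x) _).2 ⟨s.fst, s.condition⟩))
  choose l hl using key
  refine ⟨⟨α.naturality i⟩, ⟨PullbackCone.IsLimit.mk _ l (fun s ↦ ?_) hl fun s m _ h2 ↦ ?_⟩⟩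
  · have := hm x
    rw [← cancel_mono (α.app x), Category.assoc, α.naturality, reassoc_of% hl, s.condition]
  · have := hm a
    rw [← cancel_mono (α.app a), hl, h2]

theorem preservesFiniteLimits_of_mkSub_eq [PreservesFiniteLimits M]
    (hTV : TarskiVaught hD M hM A) (hA : PreservesProdsFam M A)
    (hsub : ∀ x, mkSub (α.app x) (hm x) = A x) : PreservesFiniteLimits N := by
  have : PreservesLimit (Functor.empty.{0} C) N :=
    preservesLimit_of_mono_app α hm (limit.isLimit _) fun Z g _ ↦
      (factors_iff_of_mkSub_eq (hsub (⊤_ C)) g).1 (by rw [hA.1]; exact Subobject.top_factors g)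
  have := preservesLimitsOfShape_pempty_of_preservesTerminal N
  have : PreservesLimitsOfShape (Discrete WalkingPair) N := by
    refine ⟨fun {K} ↦ ?_⟩
    have : PreservesLimit (pair (K.obj ⟨.left⟩) (K.obj ⟨.right⟩)) N := by
      refine preservesLimit_of_mono_app α hm (limit.isLimit _) fun Z g hg ↦ ?_
      refine (factors_iff_of_mkSub_eq (hsub (K.obj ⟨.left⟩ ⨯ K.obj ⟨.right⟩)) g).1 ?_
      rw [hA.2, Subobject.inf_factors, pullback_factors_iff,
        pullback_factors_iff, factors_iff_of_mkSub_eq (hsub _),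
        factors_iff_of_mkSub_eq (hsub _)]
      exact ⟨hg ⟨.left⟩, hg ⟨.right⟩⟩
    exact preservesLimit_of_iso_diagram N (diagramIsoPair K).symm
  have : PreservesFiniteProducts N := .of_preserves_binary_and_terminal N
  have : PreservesLimitsOfShape WalkingParallelPair N := by
    refine ⟨fun {K} ↦ preservesLimit_of_mono_app α hm (limit.isLimit K) fun Z g hg ↦ ?_⟩
    have : Mono (limit.π K .zero) := ⟨fun a b hab ↦ limit.hom_ext fun j ↦ by
      cases j with
      | zero => exact hab
      | one => rw [← limit.w K .left, reassoc_of% hab]⟩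
    exact (factors_iff_of_mkSub_eq (hsub (limit K)) g).1
      (hTV.factors_of_factors_map (limit.π K .zero)
        ((factors_iff_of_mkSub_eq (hsub _) _).2 (hg .zero)))
  exact preservesFiniteLimits_of_preservesEqualizers_and_finiteProducts N

theorem effectiveEpi_map_of_mkSub_eq (hTV : TarskiVaught hD M hM A)
    (hsub : ∀ x, mkSub (α.app x) (hm x) = A x) {x y : C} (f : x ⟶ y)
    [EffectiveEpi (M.map f)] : EffectiveEpi (N.map f) := by
  obtain ⟨I, p, m, hp, hmono, hpm⟩ := hD.factor (N.map f)
  obtain ⟨W, e, u, he, hu⟩ := hD.exists_effectiveEpi_lift (M.map f) (α.app y)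
  have hfac : (A y).Factors (u ≫ M.map f) :=
    (factors_iff_of_mkSub_eq (hsub y) _).2 ⟨e, hu.symm⟩
  obtain ⟨W', e', t, he', ht, ht'⟩ := hTV.exists_witness (𝟙 x) f u hfac
  rw [M.map_id, Category.comp_id] at ht'
  obtain ⟨t', rfl⟩ := (factors_iff_of_mkSub_eq (hsub x) _).1 ht'
  have h1 : t' ≫ N.map f = e' ≫ e := by
    have := hm y
    rw [← cancel_mono (α.app y), Category.assoc, α.naturality, ← Category.assoc, ht, hu,
      Category.assoc]
  have h2 : (Subobject.mk m).Factors (𝟙 (N.obj y)) := by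
    refine factors_of_effectiveEpi_comp _ e _ (factors_of_effectiveEpi_comp _ e' _ ?_)
    rw [Category.comp_id, ← h1, ← hpm]
    exact (Subobject.mk_factors_iff _ _).2 ⟨t' ≫ p, Category.assoc _ _ _⟩
  obtain ⟨r, hr⟩ := (mkSub_factors_iff m hmono _).1 h2
  have : IsSplitEpi m := ⟨⟨r, hr⟩⟩
  have : IsIso m := isIso_of_mono_of_isSplitEpi m
  rw [← hpm]
  infer_instance

theorem isCoherent_of_mkSub_eq (hM : IsCoherent hC hD M)
    (hTV : TarskiVaught hD M hM.presMono A) (hA : PreservesProdsFam M A)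
    (hsub : ∀ x, mkSub (α.app x) (hm x) = A x) : IsCoherent hC hD N := by
  have := hM.presLim.some
  have hlim := hTV.preservesFiniteLimits_of_mkSub_eq α hm hA hsub
  have hel := hTV.elementary_of_mkSub_eq α hm hsub
  have hN : PreservesMono N := fun X Y f _ ↦ inferInstance
  refine ⟨⟨hlim⟩, hN, fun X Y f hf ↦ ?_, fun {X} a b ↦ ?_, fun X ↦ ?_⟩
  · have := hM.presEpi f hf
    exact hTV.effectiveEpi_map_of_mkSub_eq α hm hsub f
  · simp only [hel.mapSub_eq_pullback hN hM.presMono, hM.map_sup, hD.sup_pullback]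
  · rw [hel.mapSub_eq_pullback hN hM.presMono, hM.map_bot, hD.bot_pullback]

end TarskiVaught

variable {N : C ⥤ D} {A : ∀ x : C, Subobject (M.obj x)}

theorem preservesProdsFam_of_mkSub_eq (hM : IsCoherent hC hD M) (hN : IsCoherent hC hD N)
    (α : N ⟶ M) (hm : ∀ x, Mono (α.app x)) (hsub : ∀ x, mkSub (α.app x) (hm x) = A x) :
    PreservesProdsFam M A := by
  have := hM.presLim.some
  have := hN.presLim.some
  refine ⟨top_unique (subobject_le_iff_factors.2 fun Z h _ ↦ ?_), fun x y ↦
    le_antisymm (subobject_le_iff_factors.2 fun Z h hh ↦ ?_)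
      (subobject_le_iff_factors.2 fun Z h hh ↦ ?_)⟩
  · rw [factors_iff_of_mkSub_eq (hsub _)]
    exact ⟨(isLimitOfHasTerminalOfPreservesLimit N).from Z,
      (isLimitOfHasTerminalOfPreservesLimit M).hom_ext _ _⟩
  · rw [factors_iff_of_mkSub_eq (hsub _)] at hh
    obtain ⟨u, rfl⟩ := hh
    rw [Subobject.inf_factors, pullback_factors_iff, pullback_factors_iff,
      factors_iff_of_mkSub_eq (hsub _), factors_iff_of_mkSub_eq (hsub _)]
    exact ⟨⟨u ≫ N.map prod.fst, by simp⟩, ⟨u ≫ N.map prod.snd, by simp⟩⟩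
  · rw [Subobject.inf_factors, pullback_factors_iff, pullback_factors_iff,
      factors_iff_of_mkSub_eq (hsub _), factors_iff_of_mkSub_eq (hsub _)] at hh
    obtain ⟨⟨a, ha⟩, ⟨b, hb⟩⟩ := hh
    rw [factors_iff_of_mkSub_eq (hsub _)]
    obtain ⟨l, hl₁, hl₂⟩ :=
      BinaryFan.IsLimit.lift' (isLimitOfHasBinaryProductOfPreservesLimit N x y) a b
    change l ≫ N.map prod.fst = a at hl₁
    change l ≫ N.map prod.snd = b at hl₂
    refine ⟨l, BinaryFan.IsLimit.hom_ext (isLimitOfHasBinaryProductOfPreservesLimit M x y) ?_ ?_⟩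
    · change (l ≫ α.app _) ≫ M.map prod.fst = h ≫ M.map prod.fst
      rw [Category.assoc, ← α.naturality, ← ha, ← hl₁, Category.assoc]
    · change (l ≫ α.app _) ≫ M.map prod.snd = h ≫ M.map prod.snd
      rw [Category.assoc, ← α.naturality, ← hb, ← hl₂, Category.assoc]

theorem tarskiVaught_of_elementary (hM : IsCoherent hC hD M) (hN : IsCoherent hC hD N)
    (α : N ⟶ M) (hm : ∀ x, Mono (α.app x)) (hel : Elementary α)
    (hsub : ∀ x, mkSub (α.app x) (hm x) = A x) : TarskiVaught hD M hM.presMono A := by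
  intro x y φ
  refine le_antisymm (subobject_le_iff_factors.2 fun Z h hh ↦ ?_)
    (subobject_le_iff_factors.2 fun Z h hh ↦ ?_)
  · rw [CoherentData.img_factors_iff] at hh ⊢
    obtain ⟨W, e, k, he, hk, hke⟩ := hh
    exact ⟨W, e, k, he, ((Subobject.inf_factors _).1 hk).1, hke⟩
  · rw [CoherentData.img_factors_iff] at hh
    obtain ⟨W, e, k, he, hk, hke⟩ := hh
    refine factors_of_effectiveEpi_comp _ e _ ?_
    rw [Subobject.inf_factors, mapSub_factors_iff, pullback_factors_iff,
      factors_iff_of_mkSub_eq (hsub _)] at hk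
    obtain ⟨⟨t, rfl⟩, u, hu⟩ := hk
    obtain ⟨I, p, m, hp, hmono, hpm⟩ := hC.factor (φ.arrow ≫ prod.snd)
    have hMpm : M.map φ.arrow ≫ M.map prod.snd = M.map p ≫ M.map m := by
      rw [← M.map_comp, ← M.map_comp, hpm]
    have hsq : u ≫ α.app y = (t ≫ M.map p) ≫ M.map m := by
      rw [hu, Category.assoc, Category.assoc, hMpm]
    have hv := (hel m hmono).lift_snd u (t ≫ M.map p) hsq
    have := hN.presEpi p hp
    obtain ⟨W', e', w, he', hw⟩ :=
      hD.exists_effectiveEpi_lift (N.map p) ((hel m hmono).lift u (t ≫ M.map p) hsq)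
    rw [CoherentData.img_factors_iff]
    have heq : (w ≫ N.map φ.arrow ≫ α.app _) ≫ M.map prod.snd = e' ≫ e ≫ h := by
      rw [← hke, α.naturality, Category.assoc, Category.assoc, hMpm, ← α.naturality_assoc,
        reassoc_of% hw, reassoc_of% hv, Category.assoc, hMpm]
    refine ⟨W', e', w ≫ N.map φ.arrow ≫ α.app _, he', ?_, heq⟩
    rw [Subobject.inf_factors, Subobject.inf_factors, mapSub_factors_iff,
      pullback_factors_iff, pullback_factors_iff,
      factors_iff_of_mkSub_eq (hsub _), factors_iff_of_mkSub_eq (hsub _)]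
    exact ⟨⟨⟨w ≫ α.app _, by simp⟩, ⟨w ≫ N.map φ.arrow ≫ N.map prod.snd, by simp⟩⟩,
      ⟨w ≫ N.map φ.arrow ≫ N.map prod.fst, by simp⟩⟩

end

/-- **Tarski–Vaught test.**  For a coherent functor `M : C ⥤ D` between coherent
categories and a family of subobjects `A x ≤ M x`, the family satisfies the
Tarski–Vaught criterion and preserves finite products iff it extends (uniquely,
as a subobject of `M` in `D^C`) to an elementary coherent subfunctor of `M`. -/
theorem tarskiVaught_test {C : Type u} [Category.{v} C] {D : Type u'} [Category.{v'} D]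
    [HasFiniteLimits C] [HasFiniteLimits D]
    (hC : CoherentData C) (hD : CoherentData D)
    (M : C ⥤ D) (hM : IsCoherent hC hD M) (A : ∀ x : C, Subobject (M.obj x)) :
    (TarskiVaught hD M hM.presMono A ∧ PreservesProdsFam M A) ↔
      ExtendsToElementarySubfunctor hC hD M A := by
  constructor
  · rintro ⟨hTV, hA⟩
    have hmap : ∀ ⦃x y : C⦄ (f : x ⟶ y), (A y).Factors ((A x).arrow ≫ M.map f) :=
      fun x y f ↦ hTV.factors_map f (Subobject.factors_self _)
    have hmono : ∀ x, Mono ((subfunctorι M A hmap).app x) := fun x ↦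
      inferInstanceAs (Mono (A x).arrow)
    have hsub : ∀ x, mkSub ((subfunctorι M A hmap).app x) (hmono x) = A x := fun x ↦
      Subobject.mk_arrow (A x)
    refine ⟨subfunctor M A hmap, TarskiVaught.isCoherent_of_mkSub_eq _ hmono hM hTV hA hsub, _,
      hmono, hTV.elementary_of_mkSub_eq _ hmono hsub, hsub, ?_⟩
    intro N' _ α' hm' _ hsub'
    exact natSub_eq_of_mkSub_eq _ _ hmono hm' fun x ↦ (hsub x).trans (hsub' x).symm
  · rintro ⟨N, hN, α, hm, hel, hsub, -⟩
    exact ⟨tarskiVaught_of_elementary hM hN α hm hel hsub,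
      preservesProdsFam_of_mkSub_eq hM hN α hm hsub⟩

end PosModel
end

section
/- Let λ be a regular cardinal and let D be a λ-pretopos. Then D has colimits of all filtered diagrams of size < λ, and these filtered colimits are stable under pullback. Moreover, any λ-geometric functor between λ-pretoposes preserves filtered colimits of size < λ. -/
open CategoryTheory CategoryTheory.Limits

universe w v u v' u'

namespace PosModel

variable {C : Type u} [Category.{v} C] {D : Type u'} [Category.{v'} D]

/-- The axioms of a `λ`-pretopos, on top of those of a coherent category:
unions of families of fewer than `λ` subobjects, stable under pullback;
disjoint and pullback-stable coproducts of families of size `< λ`; and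
Barr-exactness (every internal equivalence relation is the kernel pair of its
coequalizer). -/
structure PretoposData (D : Type u) [Category.{v} D] [HasFiniteLimits D]
    (lam : Cardinal.{v}) extends CoherentData D where
  usup : ∀ {X : D} {ι : Type v}, Cardinal.mk ι < lam → (ι → Subobject X) → Subobject X
  le_usup : ∀ {X : D} {ι : Type v} (hι : Cardinal.mk ι < lam) (a : ι → Subobject X) (i : ι),
    a i ≤ usup hι a
  usup_le : ∀ {X : D} {ι : Type v} (hι : Cardinal.mk ι < lam) (a : ι → Subobject X)
    (b : Subobject X), (∀ i, a i ≤ b) → usup hι a ≤ b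
  usup_pullback : ∀ {X Y : D} (f : X ⟶ Y) {ι : Type v} (hι : Cardinal.mk ι < lam)
    (a : ι → Subobject Y),
    (Subobject.pullback f).obj (usup hι a) = usup hι fun i => (Subobject.pullback f).obj (a i)
  hasCoprod : ∀ (ι : Type v), Cardinal.mk ι < lam → ∀ x : ι → D, HasCoproduct x
  coprod_mono : ∀ {ι : Type v} (hι : Cardinal.mk ι < lam) {x : ι → D} (c : Cofan x),
    Nonempty (IsColimit c) → ∀ i, Mono (c.inj i)
  coprod_disjoint : ∀ {ι : Type v} (hι : Cardinal.mk ι < lam) {x : ι → D} (c : Cofan x)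
    (hc : Nonempty (IsColimit c)) (i j : ι), i ≠ j →
    mkSub (c.inj i) (coprod_mono hι c hc i) ⊓ mkSub (c.inj j) (coprod_mono hι c hc j) =
      bot c.pt
  coprod_pullback : ∀ {ι : Type v} (hι : Cardinal.mk ι < lam) {x : ι → D} (c : Cofan x),
    IsColimit c → IsUniversalColimit c
  barrExact : ∀ {R X : D} (f g : R ⟶ X), Mono (prod.lift f g) →
    (∃ r : X ⟶ R, r ≫ f = 𝟙 X ∧ r ≫ g = 𝟙 X) →
    (∃ s : R ⟶ R, s ≫ prod.lift f g = prod.lift g f) →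
    (∃ t : pullback g f ⟶ R, t ≫ prod.lift f g =
      prod.lift (pullback.fst g f ≫ f) (pullback.snd g f ≫ g)) →
    ∃ (Q : D) (q : X ⟶ Q) (w : f ≫ q = g ≫ q),
      Nonempty (IsColimit (Cofork.ofπ q w)) ∧ IsPullback f g q q

/-- A `λ`-geometric functor between `λ`-pretoposes: it preserves finite limits,
effective epimorphisms and unions of fewer than `λ` subobjects. -/
structure IsGeometric {D : Type u} {E : Type u'} [Category.{v} D] [Category.{v} E]
    [HasFiniteLimits D] [HasFiniteLimits E] (lam : Cardinal.{v})
    (hD : PretoposData D lam) (hE : PretoposData E lam) (F : D ⥤ E) : Prop where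
  presLim : Nonempty (PreservesFiniteLimits F)
  presMono : PreservesMono F
  presEpi : ∀ ⦃X Y : D⦄ (f : X ⟶ Y), EffectiveEpi f → EffectiveEpi (F.map f)
  map_usup : ∀ {X : D} {ι : Type v} (hι : Cardinal.mk ι < lam) (a : ι → Subobject X),
    mapSub F presMono (hD.usup hι a) = hE.usup hι fun i => mapSub F presMono (a i)
  map_bot : ∀ X : D, mapSub F presMono (hD.bot X) = hE.bot (F.obj X)

/-- A family of morphisms with common codomain is *covering* if it does not factor through any
proper subobject. -/
def IsCovering {ι : Type*} {Y : ι → D} {X : D} (f : ∀ i, Y i ⟶ X) : Prop :=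
  ∀ ⦃A : D⦄ (m : A ⟶ X), Mono m → (∀ i, ∃ g : Y i ⟶ A, g ≫ m = f i) → IsIso m

lemma isIso_of_mono_of_section {A X : D} (m : A ⟶ X) (hm : Mono m) (s : X ⟶ A)
    (hs : s ≫ m = 𝟙 X) : IsIso m :=
  ⟨s, by rw [← cancel_mono m]; simp [hs], hs⟩

namespace IsCovering

variable {ι : Type*} {Y : ι → D} {X : D} {f : ∀ i, Y i ⟶ X}

lemma exists_lift [HasFiniteLimits D] (hf : IsCovering f) {A Z : D} (g : X ⟶ Z) (m : A ⟶ Z)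
    [Mono m] (h : ∀ i, ∃ k : Y i ⟶ A, k ≫ m = f i ≫ g) : ∃ k : X ⟶ A, k ≫ m = g := by
  have : IsIso (pullback.snd m g) := hf _ inferInstance fun i => by
    obtain ⟨k, hk⟩ := h i
    exact ⟨pullback.lift k (f i) hk, pullback.lift_snd _ _ _⟩
  exact ⟨inv (pullback.snd m g) ≫ pullback.fst m g, by simp [pullback.condition]⟩

lemma hom_ext [HasFiniteLimits D] (hf : IsCovering f) {Z : D} {a b : X ⟶ Z}
    (h : ∀ i, f i ≫ a = f i ≫ b) : a = b := by
  have : IsIso (equalizer.ι a b) :=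
    hf _ inferInstance fun i => ⟨equalizer.lift (f i) (h i), by simp⟩
  rw [← cancel_epi (equalizer.ι a b), equalizer.condition]

lemma of_strongEpi {Y X : D} (f : Y ⟶ X) [StrongEpi f] :
    IsCovering (fun _ : Unit => f) := by
  intro A m hm h
  obtain ⟨g, hg⟩ := h ()
  have sq : CommSq g f m (𝟙 X) := ⟨by simp [hg]⟩
  exact isIso_of_mono_of_section m hm sq.lift sq.fac_right

lemma comp [HasFiniteLimits D] (hf : IsCovering f) {Z : D} {q : X ⟶ Z}
    (hq : IsCovering fun _ : Unit => q) : IsCovering fun i => f i ≫ q :=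
  fun _ m hm h => hq m hm fun _ => hf.exists_lift q m h

lemma of_isColimit_cofan {X : ι → D} (c : Cofan X) (hc : IsColimit c) :
    IsCovering fun i => c.inj i := by
  intro A m hm h
  choose g hg using h
  exact isIso_of_mono_of_section m hm (Cofan.IsColimit.desc hc g)
    (Cofan.IsColimit.hom_ext hc _ _ fun i => by simp [hg])

end IsCovering

lemma CoherentData.exists_image [HasFiniteLimits D] (hD : CoherentData D) {X Y : D} (f : X ⟶ Y) :
    ∃ (a : Subobject Y) (e : X ⟶ (a : D)), EffectiveEpi e ∧ e ≫ a.arrow = f := by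
  obtain ⟨Z, e, m, he, hm, rfl⟩ := hD.factor f
  refine ⟨Subobject.mk m, e ≫ (Subobject.underlyingIso m).inv, ?_, by simp⟩
  refine hD.effectiveEpi_pullback _ (𝟙 X) (Subobject.underlyingIso m).hom e ?_ he
  have sq : CommSq (e ≫ (Subobject.underlyingIso m).inv) (𝟙 X)
      (Subobject.underlyingIso m).hom e := ⟨by
    rw [Category.assoc, Iso.inv_hom_id, Category.id_comp, Category.comp_id]⟩
  exact IsPullback.of_vert_isIso sq

lemma Subobject.le_mk_of_strongEpi {X Y A : D} {a : Subobject Y} (e : X ⟶ (a : D)) [StrongEpi e]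
    (m : A ⟶ Y) [Mono m] (g : X ⟶ A) (h : g ≫ m = e ≫ a.arrow) : a ≤ Subobject.mk m := by
  have sq : CommSq g e m a.arrow := ⟨h⟩
  exact Subobject.le_mk_of_comm sq.lift sq.fac_right

namespace PretoposData

variable [HasFiniteLimits D] {lam : Cardinal.{v'}} (hD : PretoposData D lam)
include hD

lemma exists_union {ι : Type v'} (hι : Cardinal.mk ι < lam) {Y : ι → D} {X : D}
    (f : ∀ i, Y i ⟶ X) :
    ∃ (R : D) (m : R ⟶ X) (e : ∀ i, Y i ⟶ R), Mono m ∧ (∀ i, e i ≫ m = f i) ∧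
      IsCovering e := by
  choose a e he hea using fun i => hD.exists_image (f i)
  refine ⟨(hD.usup hι a : D), (hD.usup hι a).arrow,
    fun i => e i ≫ Subobject.ofLE _ _ (hD.le_usup hι a i), inferInstance, by simp [hea], ?_⟩
  intro A m hm h
  have hle : hD.usup hι a ≤ Subobject.mk (m ≫ (hD.usup hι a).arrow) :=
    hD.usup_le hι a _ fun i => by
      obtain ⟨g, hg⟩ := h i
      exact Subobject.le_mk_of_strongEpi (e i) _ g (by simp [reassoc_of% hg])
  refine isIso_of_mono_of_section m hm (Subobject.ofLEMk _ _ hle) ?_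
  rw [← cancel_mono (hD.usup hι a).arrow]
  simp

lemma isCovering_pullback {ι : Type v'} (hι : Cardinal.mk ι < lam) {Y : ι → D} {X : D}
    {f : ∀ i, Y i ⟶ X} (hf : IsCovering f) {Z : D} (g : Z ⟶ X) :
    IsCovering fun i => pullback.snd (f i) g := by
  choose a e he hea using fun i => hD.exists_image (f i)
  have htop : hD.usup hι a = ⊤ := by
    rw [← Subobject.isIso_arrow_iff_eq_top]
    exact hf _ inferInstance fun i =>
      ⟨e i ≫ Subobject.ofLE _ _ (hD.le_usup hι a i), by simp [hea]⟩
  intro A m hm h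
  rw [Subobject.isIso_iff_mk_eq_top, ← top_le_iff, ← Subobject.pullback_top g, ← htop,
    hD.usup_pullback]
  refine hD.usup_le hι _ _ fun i => ?_
  obtain ⟨k, hk⟩ := h i
  have sq := Subobject.isPullback g (a i)
  let e' : pullback (f i) g ⟶ ((Subobject.pullback g).obj (a i) : D) :=
    sq.lift (pullback.fst (f i) g ≫ e i) (pullback.snd (f i) g)
      (by simp [hea, pullback.condition])
  have he' : e' ≫ ((Subobject.pullback g).obj (a i)).arrow = pullback.snd (f i) g :=
    sq.lift_snd _ _ _
  have : EffectiveEpi e' := by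
    refine hD.effectiveEpi_pullback e' (pullback.fst (f i) g) _ (e i)
      (IsPullback.of_right ?_ (sq.lift_fst _ _ _) sq.flip) (he i)
    rw [he', hea]
    exact (IsPullback.of_hasPullback (f i) g).flip
  exact Subobject.le_mk_of_strongEpi e' m k (hk.trans he'.symm)

lemma exists_desc {ι : Type v'} (hι : Cardinal.mk ι < lam) {Y : ι → D} {X : D}
    {f : ∀ i, Y i ⟶ X} (hf : IsCovering f) {Z : D} (h : ∀ i, Y i ⟶ Z)
    (compat : ∀ ⦃i j : ι⦄ ⦃T : D⦄ (x : T ⟶ Y i) (y : T ⟶ Y j), x ≫ f i = y ≫ f j →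
      x ≫ h i = y ≫ h j) :
    ∃ k : X ⟶ Z, ∀ i, f i ≫ k = h i := by
  obtain ⟨R, m, e, hm, hem, he⟩ := hD.exists_union hι fun i => prod.lift (f i) (h i)
  have hfst : ∀ i, e i ≫ m ≫ prod.fst = f i := fun i => by
    rw [reassoc_of% hem, prod.lift_fst]
  have hsnd : ∀ i, e i ≫ m ≫ prod.snd = h i := fun i => by
    rw [reassoc_of% hem, prod.lift_snd]
  have hmono : Mono (m ≫ (prod.fst : X ⨯ Z ⟶ X)) := ⟨fun {T} u v huv => by
    rw [← cancel_mono m]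
    refine Limits.prod.hom_ext (by simpa using huv) ?_
    refine (hD.isCovering_pullback hι he u).hom_ext fun i => ?_
    refine (hD.isCovering_pullback hι he (pullback.snd (e i) u ≫ v)).hom_ext fun j => ?_
    have hu := pullback.condition (f := e i) (g := u)
    have hv := pullback.condition (f := e j) (g := pullback.snd (e i) u ≫ v)
    simp only [Category.assoc] at hv huv ⊢
    rw [← reassoc_of% hu, ← reassoc_of% hv, hsnd, hsnd, ← Category.assoc]
    refine compat _ _ ?_
    rw [← hfst i, ← hfst j, reassoc_of% hv, Category.assoc, reassoc_of% hu, huv]⟩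
  have : IsIso (m ≫ (prod.fst : X ⨯ Z ⟶ X)) := hf _ hmono fun i => ⟨e i, hfst i⟩
  refine ⟨inv (m ≫ (prod.fst : X ⨯ Z ⟶ X)) ≫ m ≫ prod.snd, fun i => ?_⟩
  rw [← hsnd i, ← hfst i, Category.assoc, IsIso.hom_inv_id_assoc]

/-- Morphisms out of an object lying over two distinct summands of a coproduct lift through any
monomorphism. -/
lemma exists_lift_of_disjoint {ι : Type v'} (hι : Cardinal.mk ι < lam) {Y : ι → D} (c : Cofan Y)
    (hc : IsColimit c) {i j : ι} (hij : i ≠ j) {W : D} (x : W ⟶ Y i) (y : W ⟶ Y j)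
    (hxy : x ≫ c.inj i = y ≫ c.inj j) {A Z : D} (g : W ⟶ Z) (m : A ⟶ Z) [Mono m] :
    ∃ k : W ⟶ A, k ≫ m = g := by
  have hbot : (hD.bot c.pt).Factors (x ≫ c.inj i) := by
    rw [← hD.coprod_disjoint hι c ⟨hc⟩ i j hij, Subobject.inf_factors]
    have := hD.coprod_mono hι c ⟨hc⟩
    exact ⟨(Subobject.mk_factors_iff _ _).2 ⟨x, rfl⟩,
      (Subobject.mk_factors_iff _ _).2 ⟨y, hxy.symm⟩⟩
  have htop : hD.bot W = ⊤ := by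
    rw [← hD.bot_pullback (x ≫ c.inj i), ← Subobject.isIso_arrow_iff_eq_top]
    have sq := Subobject.isPullback (x ≫ c.inj i) (hD.bot c.pt)
    exact isIso_of_mono_of_section _ inferInstance
      (sq.lift (Subobject.factorThru _ _ hbot) (𝟙 W) (by simp)) (sq.lift_snd _ _ _)
  have : IsIso (pullback.snd m g) := by
    rw [Subobject.isIso_iff_mk_eq_top, ← top_le_iff, ← htop]
    exact hD.bot_le _
  exact ⟨inv (pullback.snd m g) ≫ pullback.fst m g, by simp [pullback.condition]⟩

end PretoposData

/-- The intrinsic description of filtered colimit cocones in a pretopos: the legs are jointly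
covering, and two generalized elements with the same image in the vertex are locally identified at
some stage of the diagram. -/
structure IsExact {J : Type*} [Category* J] [HasFiniteLimits D] {F : J ⥤ D} (c : Cocone F) :
    Prop where
  isCovering_ι : IsCovering fun j => c.ι.app j
  isCovering_equalizer : ∀ ⦃i j : J⦄ ⦃W : D⦄ (x : W ⟶ F.obj i) (y : W ⟶ F.obj j),
    x ≫ c.ι.app i = y ≫ c.ι.app j →
      IsCovering fun s : Σ k, (i ⟶ k) × (j ⟶ k) =>
        equalizer.ι (x ≫ F.map s.2.1) (y ≫ F.map s.2.2)

lemma mk_sigma_lt {J : Type v} [SmallCategory J] {lam : Cardinal.{v}} (hlam : lam.IsRegular)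
    (hJ : Cardinal.mk (Arrow J) < lam) :
    Cardinal.mk (Σ i j k : J, (i ⟶ k) × (j ⟶ k)) < lam := by
  refine lt_of_le_of_lt ?_ (Cardinal.mul_lt_of_lt hlam.aleph0_le hJ hJ)
  rw [Cardinal.mul_def]
  refine Cardinal.mk_le_of_injective
    (f := fun s => (Arrow.mk s.2.2.2.1, Arrow.mk s.2.2.2.2)) ?_
  rintro ⟨i, j, k, a, b⟩ ⟨i', j', k', a', b'⟩ h
  obtain ⟨h₁, h₂⟩ := Prod.ext_iff.1 h
  cases h₁
  cases h₂
  rfl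

lemma mk_obj_lt {J : Type v} [SmallCategory J] {lam : Cardinal.{v}}
    (hJ : Cardinal.mk (Arrow J) < lam) : Cardinal.mk J < lam :=
  lt_of_le_of_lt (Cardinal.mk_le_of_injective (f := fun j : J => Arrow.mk (𝟙 j))
    fun _ _ h => congrArg (fun a : Arrow J => a.left) h) hJ

lemma mk_cospan_lt {J : Type v} [SmallCategory J] {lam : Cardinal.{v}} (hlam : lam.IsRegular)
    (hJ : Cardinal.mk (Arrow J) < lam) (i j : J) :
    Cardinal.mk (Σ k : J, (i ⟶ k) × (j ⟶ k)) < lam :=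
  lt_of_le_of_lt (Cardinal.mk_le_of_injective
    (f := fun s => (⟨i, j, s⟩ : Σ i j k : J, (i ⟶ k) × (j ⟶ k)))
    fun _ _ h => by simpa using h) (mk_sigma_lt hlam hJ)

namespace IsExact

variable [HasFiniteLimits D]

lemma nonempty_isColimit {lam : Cardinal.{v'}} (hD : PretoposData D lam) {J : Type v'}
    [SmallCategory J] (hJ : Cardinal.mk (Arrow J) < lam) {F : J ⥤ D} {c : Cocone F}
    (h : IsExact c) : Nonempty (IsColimit c) := by
  have key (s : Cocone F) : ∃ k : c.pt ⟶ s.pt, ∀ j, c.ι.app j ≫ k = s.ι.app j := by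
    refine hD.exists_desc (mk_obj_lt hJ) h.isCovering_ι _ fun i j T x y hxy => ?_
    refine (h.isCovering_equalizer x y hxy).hom_ext fun ⟨k, a, b⟩ => ?_
    rw [← s.w a, ← s.w b]
    simpa using equalizer.condition (x ≫ F.map a) (y ≫ F.map b) =≫ s.ι.app k
  choose k hk using key
  exact ⟨{ desc := k, fac := hk,
           uniq := fun s m hm => h.isCovering_ι.hom_ext fun j => by rw [hm, hk] }⟩

lemma of_iso {J : Type*} [Category* J] {F : J ⥤ D} {c c' : Cocone F} (h : IsExact c)
    (e : c ≅ c') : IsExact c' := by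
  have hι (j : J) : c'.ι.app j ≫ e.inv.hom = c.ι.app j := e.inv.w j
  have hι' (j : J) : c.ι.app j ≫ e.hom.hom = c'.ι.app j := e.hom.w j
  refine ⟨fun A m hm hA => ?_, fun i j W x y hxy => h.isCovering_equalizer x y ?_⟩
  · obtain ⟨k, hk⟩ := h.isCovering_ι.exists_lift e.hom.hom m fun j => by
      simpa only [hι'] using hA j
    refine isIso_of_mono_of_section m hm (e.inv.hom ≫ k) ?_
    rw [Category.assoc, hk]
    exact congrArg CoconeMorphism.hom e.inv_hom_id
  · rw [← hι, ← hι, reassoc_of% hxy]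

lemma of_isPullback {lam : Cardinal.{v'}} (hD : PretoposData D lam) {J : Type v'}
    [SmallCategory J] (hJ : Cardinal.mk (Arrow J) < lam) {F F' : J ⥤ D} {c : Cocone F}
    (h : IsExact c) (c' : Cocone F') (α : F' ⟶ F) (f : c'.pt ⟶ c.pt)
    (hα : ∀ j, IsPullback (c'.ι.app j) (α.app j) f (c.ι.app j)) : IsExact c' := by
  refine ⟨fun A m hm hA => ?_, fun i j W x y hxy A m hm hA => ?_⟩
  · refine hD.isCovering_pullback (mk_obj_lt hJ) h.isCovering_ι f m hm fun j => ?_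
    obtain ⟨g, hg⟩ := hA j
    refine ⟨(hα j).lift (pullback.snd _ _) (pullback.fst _ _) pullback.condition.symm ≫ g, ?_⟩
    rw [Category.assoc, hg, IsPullback.lift_fst]
  · have hxy' : (x ≫ α.app i) ≫ c.ι.app i = (y ≫ α.app j) ≫ c.ι.app j := by
      rw [Category.assoc, Category.assoc, ← (hα i).w, ← (hα j).w, reassoc_of% hxy]
    refine h.isCovering_equalizer _ _ hxy' m hm fun ⟨k, a, b⟩ => ?_
    obtain ⟨g, hg⟩ := hA ⟨k, a, b⟩
    refine ⟨equalizer.lift (equalizer.ι _ _) ((hα k).hom_ext ?_ ?_) ≫ g, ?_⟩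
    · simp [hxy]
    · simpa using equalizer.condition ((x ≫ α.app i) ≫ F.map a) ((y ≫ α.app j) ≫ F.map b)
    · rw [Category.assoc, hg, equalizer.lift_ι]

end IsExact

namespace IsGeometric

variable {E : Type u} [Category.{v'} E] [HasFiniteLimits D] [HasFiniteLimits E]
  {lam : Cardinal.{v'}} {hD : PretoposData D lam} {hE : PretoposData E lam} {G : D ⥤ E}

lemma isCovering_map (hG : IsGeometric lam hD hE G) {ι : Type v'} (hι : Cardinal.mk ι < lam)
    {Y : ι → D} {X : D} {f : ∀ i, Y i ⟶ X} (hf : IsCovering f) :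
    IsCovering fun i => G.map (f i) := by
  choose a e he hea using fun i => hD.exists_image (f i)
  have hiso : IsIso (hD.usup hι a).arrow := hf _ inferInstance fun i =>
    ⟨e i ≫ Subobject.ofLE _ _ (hD.le_usup hι a i), by simp [hea]⟩
  have htop : mapSub G hG.presMono (hD.usup hι a) = ⊤ := Subobject.mk_eq_top_of_isIso _
  intro A m hm h
  rw [Subobject.isIso_iff_mk_eq_top, ← top_le_iff, ← htop, hG.map_usup]
  refine hE.usup_le hι _ _ fun i => ?_
  obtain ⟨g, hg⟩ := h i
  have := hG.presEpi (e i) (he i)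
  have := hG.presMono (a i).arrow inferInstance
  have sq : CommSq g (G.map (e i)) m (G.map (a i).arrow) := ⟨by
    rw [hg, ← G.map_comp, hea]⟩
  exact Subobject.mk_le_mk_of_comm sq.lift sq.fac_right

lemma isExact_mapCocone (hG : IsGeometric lam hD hE G) (hlam : lam.IsRegular) {J : Type v'}
    [SmallCategory J] (hJ : Cardinal.mk (Arrow J) < lam) {F : J ⥤ D} {c : Cocone F}
    (h : IsExact c) : IsExact (G.mapCocone c) := by
  obtain ⟨_⟩ := hG.presLim
  refine ⟨hG.isCovering_map (mk_obj_lt hJ) h.isCovering_ι, fun i j W x y hxy A m hm hA => ?_⟩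
  have sq := (IsPullback.of_hasPullback (c.ι.app i) (c.ι.app j)).map G
  let t := sq.lift x y hxy
  have hcov := hE.isCovering_pullback (mk_cospan_lt hlam hJ i j)
    (hG.isCovering_map (mk_cospan_lt hlam hJ i j)
      (h.isCovering_equalizer _ _ pullback.condition)) t
  refine hcov m hm fun ⟨k, a, b⟩ => ?_
  obtain ⟨g, hg⟩ := hA ⟨k, a, b⟩
  refine ⟨equalizer.lift (pullback.snd _ t) ?_ ≫ g, ?_⟩
  · have hx : t ≫ G.map (pullback.fst _ _) = x := sq.lift_fst _ _ _
    have hy : t ≫ G.map (pullback.snd _ _) = y := sq.lift_snd _ _ _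
    dsimp only
    rw [← hx, ← hy]
    simp only [Category.assoc, ← pullback.condition_assoc, Functor.comp_map, ← G.map_comp]
    rw [equalizer.condition]
  · rw [Category.assoc, hg, equalizer.lift_ι]

end IsGeometric

namespace PretoposData

variable [HasFiniteLimits D] {lam : Cardinal.{v'}} (hD : PretoposData D lam)
include hD

lemma exists_quotient {R X : D} (f g : R ⟶ X) (hm : Mono (prod.lift f g))
    (hrefl : ∃ r : X ⟶ R, r ≫ prod.lift f g = prod.lift (𝟙 X) (𝟙 X))
    (hsymm : ∃ s : R ⟶ R, s ≫ prod.lift f g = prod.lift g f)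
    (htrans : ∃ t : pullback g f ⟶ R, t ≫ prod.lift f g =
      prod.lift (pullback.fst g f ≫ f) (pullback.snd g f ≫ g)) :
    ∃ (Q : D) (q : X ⟶ Q), IsCovering (fun _ : Unit => q) ∧ IsPullback f g q q := by
  obtain ⟨r, hr⟩ := hrefl
  obtain ⟨Q, q, w, ⟨hq⟩, hpb⟩ := hD.barrExact f g hm
    ⟨r, by simpa [prod.lift_fst] using hr =≫ prod.fst,
      by simpa [prod.lift_snd] using hr =≫ prod.snd⟩ hsymm htrans
  have : StrongEpi q := by
    have : IsRegularEpi q := ⟨⟨⟨R, f, g, w, hq⟩⟩⟩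
    infer_instance
  exact ⟨Q, q, .of_strongEpi q, hpb⟩

lemma exists_isExact (hlam : lam.IsRegular) {J : Type v'} [SmallCategory J] [IsFiltered J]
    (hJ : Cardinal.mk (Arrow J) < lam) (F : J ⥤ D) : ∃ c : Cocone F, IsExact c := by
  have hJ' := mk_obj_lt hJ
  have hα := mk_sigma_lt hlam hJ
  have := hD.hasCoprod J hJ' F.obj
  obtain ⟨c, ⟨hc⟩⟩ : ∃ c : Cofan F.obj, Nonempty (IsColimit c) :=
    ⟨_, ⟨coproductIsCoproduct F.obj⟩⟩
  have hcov := IsCovering.of_isColimit_cofan c hc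
  have hmono := hD.coprod_mono hJ' c ⟨hc⟩
  let P (s : Σ i j k : J, (i ⟶ k) × (j ⟶ k)) : D :=
    pullback (F.map s.2.2.2.1) (F.map s.2.2.2.2)
  let p₁ (s) : P s ⟶ F.obj s.1 := pullback.fst _ _
  let p₂ (s) : P s ⟶ F.obj s.2.1 := pullback.snd _ _
  have hp (s) : p₁ s ≫ F.map s.2.2.2.1 = p₂ s ≫ F.map s.2.2.2.2 := pullback.condition
  obtain ⟨R, m, e, hm, hem, he⟩ := hD.exists_union hα fun s =>
    prod.lift (p₁ s ≫ c.inj s.1) (p₂ s ≫ c.inj s.2.1)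
  obtain ⟨f, g, rfl⟩ : ∃ f g : R ⟶ c.pt, prod.lift f g = m :=
    ⟨m ≫ prod.fst, m ≫ prod.snd, by ext <;> simp [prod.lift_fst, prod.lift_snd]⟩
  have hef (s) : e s ≫ f = p₁ s ≫ c.inj s.1 := by simpa [prod.lift_fst] using hem s =≫ prod.fst
  have heg (s) : e s ≫ g = p₂ s ≫ c.inj s.2.1 := by simpa [prod.lift_snd] using hem s =≫ prod.snd
  have lift {i j k : J} (a : i ⟶ k) (b : j ⟶ k) {W : D} (x : W ⟶ F.obj i) (y : W ⟶ F.obj j)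
      (hxy : x ≫ F.map a = y ≫ F.map b) :
      ∃ r : W ⟶ R, r ≫ prod.lift f g = prod.lift (x ≫ c.inj i) (y ≫ c.inj j) := by
    let l : W ⟶ P ⟨i, j, k, a, b⟩ := pullback.lift x y hxy
    have hl₁ : l ≫ p₁ _ = x := pullback.lift_fst _ _ _
    have hl₂ : l ≫ p₂ _ = y := pullback.lift_snd _ _ _
    exact ⟨l ≫ e _, by rw [Category.assoc, hem, prod.comp_lift, reassoc_of% hl₁, reassoc_of% hl₂]⟩
  obtain ⟨Q, q, hq, hpb⟩ := hD.exists_quotient f g hm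
    (hcov.exists_lift _ _ fun i => by
      simpa using lift (𝟙 i) (𝟙 i) (𝟙 _) (𝟙 _) rfl)
    (he.exists_lift _ _ fun s => by
      simpa [hef, heg] using lift s.2.2.2.2 s.2.2.2.1 (p₂ s) (p₁ s) (hp s).symm)
    (by
      refine (hD.isCovering_pullback hα he (pullback.fst g f)).exists_lift _ _ fun s => ?_
      refine (hD.isCovering_pullback hα he
        (pullback.snd (e s) (pullback.fst g f) ≫ pullback.snd g f)).exists_lift _ _ fun s' => ?_
      set π := pullback.snd (e s) (pullback.fst g f)
      set π' := pullback.snd (e s') (π ≫ pullback.snd g f)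
      set ρ := pullback.fst (e s) (pullback.fst g f)
      set ρ' := pullback.fst (e s') (π ≫ pullback.snd g f)
      have h₁ : ρ ≫ e s = π ≫ pullback.fst g f := pullback.condition
      have h₂ : ρ' ≫ e s' = π' ≫ π ≫ pullback.snd g f := pullback.condition
      have hmid : (π' ≫ ρ ≫ p₂ s) ≫ c.inj s.2.1 = (ρ' ≫ p₁ s') ≫ c.inj s'.1 := by
        simp only [Category.assoc]
        rw [← hef, ← heg, reassoc_of% h₁, reassoc_of% h₂, pullback.condition]
      have hgoal : π' ≫ π ≫ prod.lift (pullback.fst g f ≫ f) (pullback.snd g f ≫ g) =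
          prod.lift ((π' ≫ ρ ≫ p₁ s) ≫ c.inj s.1) ((ρ' ≫ p₂ s') ≫ c.inj s'.2.1) := by
        ext
        · simp [prod.lift_fst, ← hef, reassoc_of% h₁]
        · simp [prod.lift_snd, ← heg, reassoc_of% h₂]
      rw [hgoal]
      clear_value π π' ρ ρ'
      clear hgoal h₁ h₂
      obtain ⟨i, j, k, a, b⟩ := s
      obtain ⟨i', j', k', a', b'⟩ := s'
      by_cases hij : j = i'
      · subst hij
        have := hmono j
        dsimp only at hmid
        rw [cancel_mono] at hmid
        obtain ⟨l, u, v, huv⟩ := IsFiltered.span b a'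
        refine lift (a ≫ u) (b' ≫ v) _ _ ?_
        have h₁ := hp ⟨i, j, k, a, b⟩
        have h₂ := hp ⟨j, j', k', a', b'⟩
        dsimp only at h₁ h₂
        simp only [Category.assoc, F.map_comp] at hmid ⊢
        rw [reassoc_of% h₁, ← reassoc_of% h₂, ← F.map_comp, huv, F.map_comp,
          reassoc_of% hmid]
      · exact hD.exists_lift_of_disjoint hJ' c hc hij _ _ hmid _ _)
  let c' : Cocone F :=
    { pt := Q
      ι :=
        { app := fun i => c.inj i ≫ q
          naturality := fun i j a => by
            obtain ⟨r, hr⟩ := lift a (𝟙 j) (𝟙 _) (F.map a) (by simp)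
            have h₁ : r ≫ f = c.inj i := by simpa [prod.lift_fst] using hr =≫ prod.fst
            have h₂ : r ≫ g = F.map a ≫ c.inj j := by simpa [prod.lift_snd] using hr =≫ prod.snd
            simp [← reassoc_of% h₂, ← h₁, hpb.w] } }
  refine ⟨c', hcov.comp hq, fun i j W x y hxy A n hn hA => ?_⟩
  let t : W ⟶ R := hpb.lift (x ≫ c.inj i) (y ≫ c.inj j) (by simpa [c'] using hxy)
  have htf : t ≫ f = x ≫ c.inj i := hpb.lift_fst _ _ _
  have htg : t ≫ g = y ≫ c.inj j := hpb.lift_snd _ _ _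
  refine hD.isCovering_pullback hα he t n hn fun s => ?_
  set π := pullback.snd (e s) t
  set ρ := pullback.fst (e s) t
  have hπ : ρ ≫ e s = π ≫ t := pullback.condition
  have h₁ : (π ≫ x) ≫ c.inj i = (ρ ≫ p₁ s) ≫ c.inj s.1 := by
    simp only [Category.assoc]
    rw [← hef, reassoc_of% hπ, htf]
  have h₂ : (π ≫ y) ≫ c.inj j = (ρ ≫ p₂ s) ≫ c.inj s.2.1 := by
    simp only [Category.assoc]
    rw [← heg, reassoc_of% hπ, htg]
  change ∃ k, k ≫ n = π
  clear_value π ρ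
  clear hπ
  obtain ⟨i', j', k, a, b⟩ := s
  by_cases hi : i = i'
  · by_cases hj : j = j'
    · subst hi hj
      have := hmono i
      have := hmono j
      dsimp only at h₁ h₂
      rw [cancel_mono] at h₁ h₂
      obtain ⟨l, hl⟩ := hA ⟨k, a, b⟩
      refine ⟨equalizer.lift π ?_ ≫ l, by rw [Category.assoc, hl, equalizer.lift_ι]⟩
      have := hp ⟨i, j, k, a, b⟩
      dsimp only at this ⊢
      rw [← Category.assoc, ← Category.assoc, h₁, h₂, Category.assoc, Category.assoc, this]
    · exact hD.exists_lift_of_disjoint hJ' c hc hj _ _ h₂ _ _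
  · exact hD.exists_lift_of_disjoint hJ' c hc hi _ _ h₁ _ _

end PretoposData

/-- A `λ`-pretopos (`λ` a regular cardinal) has colimits of all filtered
diagrams of size `< λ`, these colimits are stable under pullback (they are
universal), and any `λ`-geometric functor between `λ`-pretoposes preserves
them. -/
theorem pretopos_filtered_colimits {D : Type u} {E : Type u'}
    [Category.{v} D] [Category.{v} E] [HasFiniteLimits D] [HasFiniteLimits E]
    (lam : Cardinal.{v}) (hlam : lam.IsRegular)
    (hD : PretoposData D lam) (hE : PretoposData E lam)
    (J : Type v) [SmallCategory J] [IsFiltered J]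
    (hJ : Cardinal.mk (Arrow J) < lam) :
    HasColimitsOfShape J D ∧
      (∀ (F : J ⥤ D) (c : Cocone F), IsColimit c → IsUniversalColimit c) ∧
      (∀ (G : D ⥤ E), IsGeometric lam hD hE G →
        Nonempty (PreservesColimitsOfShape J G)) := by
  have exact_of_isColimit (F : J ⥤ D) (c : Cocone F) (hc : IsColimit c) : IsExact c := by
    obtain ⟨c₀, h₀⟩ := hD.exists_isExact hlam hJ F
    obtain ⟨hc₀⟩ := h₀.nonempty_isColimit hD hJ
    exact h₀.of_iso (hc₀.uniqueUpToIso hc)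
  refine ⟨⟨fun F => ?_⟩, fun F c hc F' c' α f _ _ hpb => ?_,
    fun G hG => ⟨⟨fun {F} => ⟨fun {c} hc => ?_⟩⟩⟩⟩
  · obtain ⟨c, h⟩ := hD.exists_isExact hlam hJ F
    obtain ⟨hc⟩ := h.nonempty_isColimit hD hJ
    exact ⟨⟨c, hc⟩⟩
  · exact ((exact_of_isColimit F c hc).of_isPullback hD hJ c' α f hpb).nonempty_isColimit hD hJ
  · exact (hG.isExact_mapCocone hlam hJ (exact_of_isColimit F c hc)).nonempty_isColimit hE hJ

end PosModel
end

section
/- Let λ be a regular cardinal and let D be a λ-pretopos. Then filtered colimits of size < λ commute with finite limits in D: for any filtered category I of size < λ and finite category J, the canonical comparison map from the colimit over I of the limits over J to the limit over J of the colimits over I is an isomorphism. -/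
open CategoryTheory CategoryTheory.Limits

universe w v u v' u'

namespace PosModel

variable {C : Type u} [Category.{v} C] {D : Type u'} [Category.{v'} D]

section CanonicalTopology

lemma isSheafFor_yoneda_of_isColimit_cofan {ι : Type*} {Y : ι → D} {c : Cofan Y}
    (hc : IsColimit c) (W : D) : (Presieve.ofArrows Y c.inj).IsSheafFor (yoneda.obj W) := by
  rw [Presieve.isSheafFor_arrows_iff]
  intro x _
  exact ⟨Cofan.IsColimit.desc hc x, fun i => Cofan.IsColimit.fac hc x i,
    fun t ht => Cofan.IsColimit.hom_ext hc _ _ fun i =>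
      (ht i).trans (Cofan.IsColimit.fac hc x i).symm⟩

lemma hom_ext_of_mem_canonicalTopology {Z W : D} {a b : Z ⟶ W} {S : Sieve Z}
    (hS : S ∈ Sheaf.canonicalTopology D Z) (h : ∀ ⦃Y : D⦄ (g : Y ⟶ Z), S g → g ≫ a = g ≫ b) :
    a = b :=
  (Sheaf.isSheaf_yoneda_obj W S hS).isSeparatedFor.ext fun _ g hg => h g hg

lemma exists_lift_of_mem_canonicalTopology {Z R X : D} (m : R ⟶ X) [Mono m] (h : Z ⟶ X)
    {S : Sieve Z} (hS : S ∈ Sheaf.canonicalTopology D Z)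
    (hl : ∀ ⦃Y : D⦄ (g : Y ⟶ Z), S g → ∃ l : Y ⟶ R, l ≫ m = g ≫ h) : ∃ l : Z ⟶ R, l ≫ m = h := by
  choose l hl using hl
  let x : Presieve.FamilyOfElements (yoneda.obj R) S.arrows := fun Y g hg => l g hg
  have hx : x.Compatible := by
    intro Y₁ Y₂ Z' g₁ g₂ f₁ f₂ h₁ h₂ w
    change g₁ ≫ l f₁ h₁ = g₂ ≫ l f₂ h₂
    simp only [← cancel_mono m, Category.assoc, hl, reassoc_of% w]
  obtain ⟨t, ht, -⟩ := Sheaf.isSheaf_yoneda_obj R S hS x hx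
  refine ⟨t, hom_ext_of_mem_canonicalTopology hS fun Y g hg => ?_⟩
  have : g ≫ t = l g hg := ht g hg
  rw [← hl g hg, ← this, Category.assoc]

variable [HasFiniteLimits D]

lemma ofArrows_mem_canonicalTopology {ι : Type*} {X : D} {Y : ι → D} (f : ∀ i, Y i ⟶ X)
    (h : ∀ ⦃Z : D⦄ (g : Z ⟶ X) (W : D),
      (Presieve.ofArrows _ fun i => pullback.fst g (f i)).IsSheafFor (yoneda.obj W)) :
    Sieve.ofArrows Y f ∈ Sheaf.canonicalTopology D X := by
  refine Sheaf.mem_finestTopology_of_forall_isSheafFor ?_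
  rintro _ ⟨W, rfl⟩ Z g
  rw [← Sieve.ofArrows_eq_pullback_of_isPullback f
    fun i => IsPullback.of_hasPullback g (f i)]
  exact (Presieve.isSheafFor_iff_generate _).1 (h g W)

lemma generateSingleton_mem_canonicalTopology (hD : CoherentData D) {X Y : D} (e : Y ⟶ X)
    (he : EffectiveEpi e) : Sieve.generateSingleton e ∈ Sheaf.canonicalTopology D X := by
  have key : Sieve.ofArrows _ (fun _ : PUnit.{1} => e) ∈ Sheaf.canonicalTopology D X := by
    refine ofArrows_mem_canonicalTopology _ fun Z g W => ?_
    have := hD.effectiveEpi_pullback _ _ _ _ (IsPullback.of_hasPullback g e) he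
    rw [Presieve.ofArrows_pUnit]
    exact Presieve.IsSheafFor.singleton_of_isRepresentable_of_effectiveEpi _ _
  rwa [Sieve.ofArrows, Presieve.ofArrows_pUnit, Sieve.generateSingleton_eq] at key

lemma ofArrows_inj_mem_canonicalTopology {ι : Type*} {Y : ι → D} {c : Cofan Y}
    (hc : IsUniversalColimit c) : Sieve.ofArrows Y c.inj ∈ Sheaf.canonicalTopology D c.pt := by
  refine ofArrows_mem_canonicalTopology _ fun Z g W => ?_
  obtain ⟨hd⟩ := hc.nonempty_isColimit_of_isPullback_left c.inj (𝟙 _) g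
    (fun i => pullback.fst g (c.inj i)) (fun i => pullback.snd g (c.inj i))
    (fun i => IsPullback.of_hasPullback g (c.inj i))
    (IsPullback.id_vert g).flip
    (Cofan.mk Z fun i => pullback.fst g (c.inj i)) (Iso.refl Z)
    (by simp) (by simp) (by simp [pullback.condition])
  exact isSheafFor_yoneda_of_isColimit_cofan hd W

end CanonicalTopology

section Disjointness

variable [HasFiniteLimits D] {lam : Cardinal.{v'}}

lemma bot_mem_canonicalTopology_of_hom_bot (hlam : 0 < lam) (hD : PretoposData D lam) {X Z : D}
    (a : Z ⟶ (hD.bot X : D)) : (⊥ : Sieve Z) ∈ Sheaf.canonicalTopology D Z := by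
  have hE : Cardinal.mk PEmpty.{v' + 1} < lam := by simpa using hlam
  let x : PEmpty.{v' + 1} → D := PEmpty.elim
  have := hD.hasCoprod _ hE x
  have key : ∀ {Y : D} (_ : Y ⟶ ∐ x), (⊥ : Sieve Y) ∈ Sheaf.canonicalTopology D Y := by
    intro Y g
    have h := (Sheaf.canonicalTopology D).pullback_stable g (ofArrows_inj_mem_canonicalTopology
      (hD.coprod_pullback hE _ (coproductIsCoproduct x)))
    convert h
    ext W k
    simp only [Sieve.bot_apply, Sieve.pullback_apply, Sieve.mem_ofArrows_iff, false_iff]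
    rintro ⟨i, -⟩
    exact i.elim
  let j : ∐ x ⟶ X := Sigma.desc fun i => i.elim
  have hj : Mono j := ⟨fun g h _ => hom_ext_of_mem_canonicalTopology (key g) (by simp)⟩
  exact key (a ≫ Subobject.ofLEMk _ j (hD.bot_le (Subobject.mk j)))

lemma bot_mem_canonicalTopology_of_inj_eq (hlam : 0 < lam) (hD : PretoposData D lam)
    {ι : Type v'} (hι : Cardinal.mk ι < lam) {x : ι → D} {c : Cofan x} (hc : IsColimit c)
    {i j : ι} (hij : i ≠ j) {Z : D} {a : Z ⟶ x i} {b : Z ⟶ x j} (w : a ≫ c.inj i = b ≫ c.inj j) :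
    (⊥ : Sieve Z) ∈ Sheaf.canonicalTopology D Z := by
  have hi := hD.coprod_mono hι c ⟨hc⟩ i
  have hj := hD.coprod_mono hι c ⟨hc⟩ j
  have h : (Subobject.mk (c.inj i) ⊓ Subobject.mk (c.inj j)).Factors (a ≫ c.inj i) := by
    rw [Subobject.inf_factors]
    exact ⟨⟨a, rfl⟩, ⟨b, w.symm⟩⟩
  have h' : (hD.bot c.pt).Factors (a ≫ c.inj i) := by
    rw [← hD.coprod_disjoint hι c ⟨hc⟩ i j hij]
    exact h
  exact bot_mem_canonicalTopology_of_hom_bot hlam hD (Subobject.factorThru _ _ h')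

end Disjointness

section FilteredRelation

variable {K : Type v'} [SmallCategory K]

/-- The sieve of morphisms along which two generalized elements of a coproduct of the objects
of a diagram `H` lift to summands, in such a way that the lifts become equal further along `H`. -/
def eventuallyEqSieve (H : K ⥤ D) (c : Cofan H.obj) {Z : D} (a b : Z ⟶ c.pt) : Sieve Z where
  arrows Y g := ∃ (k l m : K) (u : k ⟶ m) (v : l ⟶ m) (a' : Y ⟶ H.obj k) (b' : Y ⟶ H.obj l),
    a' ≫ c.inj k = g ≫ a ∧ b' ≫ c.inj l = g ≫ b ∧ a' ≫ H.map u = b' ≫ H.map v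
  downward_closed := by
    rintro Y Y' g ⟨k, l, m, u, v, a', b', ha, hb, h⟩ f
    exact ⟨k, l, m, u, v, f ≫ a', f ≫ b', by simp [ha], by simp [hb], by simp [h]⟩

variable {H : K ⥤ D} {c : Cofan H.obj}

lemma eventuallyEqSieve_symm {Z : D} (a b : Z ⟶ c.pt) :
    eventuallyEqSieve H c a b ≤ eventuallyEqSieve H c b a := by
  rintro Y g ⟨k, l, m, u, v, a', b', ha, hb, h⟩
  exact ⟨l, k, m, v, u, b', a', hb, ha, h.symm⟩

variable [HasFiniteLimits D]

lemma eventuallyEqSieve_self_mem (hc : IsUniversalColimit c) {Z : D} (a : Z ⟶ c.pt) :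
    eventuallyEqSieve H c a a ∈ Sheaf.canonicalTopology D Z := by
  refine (Sheaf.canonicalTopology D).superset_covering ?_
    ((Sheaf.canonicalTopology D).pullback_stable a (ofArrows_inj_mem_canonicalTopology hc))
  intro Y g hg
  obtain ⟨k, a', h⟩ := (Sieve.mem_ofArrows_iff ..).1 hg
  exact ⟨k, k, k, 𝟙 k, 𝟙 k, a', a', h.symm, h.symm, rfl⟩

variable {lam : Cardinal.{v'}}

lemma mk_lt_of_mk_arrow_lt (hK : Cardinal.mk (Arrow K) < lam) : Cardinal.mk K < lam :=
  (Cardinal.mk_le_of_injective (f := fun k : K => Arrow.mk (𝟙 k))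
    fun _ _ h => congrArg Comma.left h).trans_lt hK

lemma eventuallyEqSieve_trans_mem [IsFiltered K] (hlam : 0 < lam) (hD : PretoposData D lam)
    (hK : Cardinal.mk K < lam) (hc : IsColimit c) {Z : D} {x y z : Z ⟶ c.pt}
    (hxy : eventuallyEqSieve H c x y ∈ Sheaf.canonicalTopology D Z)
    (hyz : eventuallyEqSieve H c y z ∈ Sheaf.canonicalTopology D Z) :
    eventuallyEqSieve H c x z ∈ Sheaf.canonicalTopology D Z := by
  refine (Sheaf.canonicalTopology D).transitive
    ((Sheaf.canonicalTopology D).intersection_covering hxy hyz) _ ?_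
  rintro Y g ⟨⟨k, l, m, u, v, a, b, ha, hb, h⟩, ⟨l', n, m', u', v', b', d, hb', hd, h'⟩⟩
  by_cases hl : l = l'
  · subst hl
    have := hD.coprod_mono hK c ⟨hc⟩ l
    obtain rfl : b = b' := by rw [← cancel_mono (c.inj l), hb, hb']
    refine (Sheaf.canonicalTopology D).superset_covering ?_
      ((Sheaf.canonicalTopology D).top_mem Y)
    obtain ⟨p, s, t, hst⟩ := IsFiltered.span v u'
    rintro W f -
    refine ⟨k, n, p, u ≫ s, v' ≫ t, f ≫ a, f ≫ d, by simp [ha], by simp [hd], ?_⟩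
    have e₁ : b ≫ H.map v ≫ H.map s = b ≫ H.map u' ≫ H.map t := by
      rw [← H.map_comp, hst, H.map_comp]
    simp only [H.map_comp, Category.assoc, reassoc_of% h, ← reassoc_of% h', e₁]
  · exact (Sheaf.canonicalTopology D).superset_covering bot_le
      (bot_mem_canonicalTopology_of_inj_eq hlam hD hK hc hl (hb.trans hb'.symm))

/-- The pairs of morphisms of `K` with a common target. -/
abbrev CospanIndex (K : Type v') [SmallCategory K] : Type v' :=
  Σ k l m : K, (k ⟶ m) × (l ⟶ m)

lemma mk_cospanIndex_lt (hlam : Cardinal.aleph0 ≤ lam) (hK : Cardinal.mk (Arrow K) < lam) :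
    Cardinal.mk (CospanIndex K) < lam := by
  refine (Cardinal.mk_le_of_injective
    (f := fun p : CospanIndex K => (Arrow.mk p.2.2.2.1, Arrow.mk p.2.2.2.2)) ?_).trans_lt
      ((Cardinal.mk_prod _ _).trans_lt (by simpa using Cardinal.mul_lt_of_lt hlam hK hK))
  rintro ⟨k, l, m, u, v⟩ ⟨k', l', m', u', v'⟩ h
  simp only [Prod.mk.injEq] at h
  obtain ⟨h₁, h₂⟩ := h
  obtain rfl : k = k' := congrArg Comma.left h₁
  obtain rfl : m = m' := congrArg Comma.right h₁
  obtain rfl : l = l' := congrArg Comma.left h₂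
  obtain rfl := Arrow.mk_injective _ _ h₁
  obtain rfl := Arrow.mk_injective _ _ h₂
  rfl

/-- The relation given by `eventuallyEqSieve` is representable by a subobject of `X × X`. -/
lemma exists_relation (hlam : Cardinal.aleph0 ≤ lam) (hD : PretoposData D lam)
    (hK : Cardinal.mk (Arrow K) < lam) :
    ∃ (R : D) (f g : R ⟶ c.pt), Mono (prod.lift f g) ∧ ∀ {Z : D} (a b : Z ⟶ c.pt),
      (∃ l : Z ⟶ R, l ≫ f = a ∧ l ≫ g = b) ↔
        eventuallyEqSieve H c a b ∈ Sheaf.canonicalTopology D Z := by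
  let x : CospanIndex K → D := fun p => pullback (H.map p.2.2.2.1) (H.map p.2.2.2.2)
  have hx := mk_cospanIndex_lt hlam hK
  have := hD.hasCoprod _ hx x
  let r : ∐ x ⟶ c.pt ⨯ c.pt := Sigma.desc fun p =>
    prod.lift (pullback.fst _ _ ≫ c.inj p.1) (pullback.snd _ _ ≫ c.inj p.2.1)
  obtain ⟨R, e, m, he, hm, hr⟩ := hD.factor r
  have hl : prod.lift (m ≫ prod.fst) (m ≫ prod.snd) = m :=
    prod.hom_ext (prod.lift_fst _ _) (prod.lift_snd _ _)
  have hι (p : CospanIndex K) : Sigma.ι x p ≫ e ≫ m =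
      prod.lift (pullback.fst _ _ ≫ c.inj p.1) (pullback.snd _ _ ≫ c.inj p.2.1) := by
    rw [hr]; simp [r]
  refine ⟨R, m ≫ prod.fst, m ≫ prod.snd, by rwa [hl], fun {Z} a b => ⟨?_, fun h => ?_⟩⟩
  · rintro ⟨l, rfl, rfl⟩
    refine (Sheaf.canonicalTopology D).transitive
      ((Sheaf.canonicalTopology D).pullback_stable l
        (generateSingleton_mem_canonicalTopology hD.toCoherentData e he)) _ ?_
    rintro Y g ⟨t, ht⟩
    refine (Sheaf.canonicalTopology D).superset_covering ?_
      ((Sheaf.canonicalTopology D).pullback_stable t (ofArrows_inj_mem_canonicalTopology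
        (hD.coprod_pullback hx _ (coproductIsCoproduct x))))
    intro W s hs
    obtain ⟨p, w, hw⟩ := (Sieve.mem_ofArrows_iff ..).1 hs
    have key : s ≫ g ≫ l ≫ m = w ≫ prod.lift (pullback.fst _ _ ≫ c.inj p.1)
        (pullback.snd _ _ ≫ c.inj p.2.1) := by
      rw [← hι, ← reassoc_of% ht]
      exact (reassoc_of% hw) (e ≫ m)
    refine ⟨p.1, p.2.1, p.2.2.1, p.2.2.2.1, p.2.2.2.2, w ≫ pullback.fst _ _,
      w ≫ pullback.snd _ _, ?_, ?_, by simp [pullback.condition]⟩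
    · simpa only [Category.assoc, prod.lift_fst] using (congrArg (· ≫ prod.fst) key).symm
    · simpa only [Category.assoc, prod.lift_snd] using (congrArg (· ≫ prod.snd) key).symm
  · obtain ⟨l, hl⟩ := exists_lift_of_mem_canonicalTopology m (prod.lift a b) h (by
      rintro Y g ⟨k, l, n, u, v, a', b', ha, hb, h⟩
      refine ⟨pullback.lift a' b' h ≫ Sigma.ι x ⟨k, l, n, u, v⟩ ≫ e, ?_⟩
      simp only [Category.assoc, hι]
      refine prod.hom_ext ?_ ?_
      · simp only [Category.assoc, prod.lift_fst, pullback.lift_fst_assoc, ha]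
      · simp only [Category.assoc, prod.lift_snd, pullback.lift_snd_assoc, hb])
    exact ⟨l, by rw [reassoc_of% hl, prod.lift_fst], by rw [reassoc_of% hl, prod.lift_snd]⟩

/-- The relation given by `eventuallyEqSieve` is the kernel pair of a morphism. -/
lemma exists_quotient [IsFiltered K] (hlam : Cardinal.aleph0 ≤ lam) (hD : PretoposData D lam)
    (hK : Cardinal.mk (Arrow K) < lam) (hc : IsColimit c) :
    ∃ (Q : D) (q : c.pt ⟶ Q), ∀ {Z : D} (a b : Z ⟶ c.pt), a ≫ q = b ≫ q ↔
      eventuallyEqSieve H c a b ∈ Sheaf.canonicalTopology D Z := by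
  have hK' := mk_lt_of_mk_arrow_lt hK
  obtain ⟨R, f, g, hfg, hR⟩ := exists_relation (c := c) hlam hD hK
  obtain ⟨Q, q, w, -, hq⟩ := hD.barrExact f g hfg
    ((hR (𝟙 _) (𝟙 _)).2 (eventuallyEqSieve_self_mem (hD.coprod_pullback hK' c hc) _))
    (by
      obtain ⟨s, h₁, h₂⟩ := (hR g f).2 ((Sheaf.canonicalTopology D).superset_covering
        (eventuallyEqSieve_symm _ _) ((hR f g).1 ⟨𝟙 R, by simp, by simp⟩))
      exact ⟨s, by ext <;> simp [h₁, h₂]⟩)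
    (by
      obtain ⟨t, h₁, h₂⟩ := (hR (pullback.fst g f ≫ f) (pullback.snd g f ≫ g)).2
        (eventuallyEqSieve_trans_mem (Cardinal.aleph0_pos.trans_le hlam) hD hK' hc
          ((hR _ (pullback.fst g f ≫ g)).1 ⟨pullback.fst g f, rfl, rfl⟩)
          ((hR _ _).1 ⟨pullback.snd g f, pullback.condition.symm, rfl⟩))
      exact ⟨t, by ext <;> simp [h₁, h₂]⟩)
  refine ⟨Q, q, fun {Z} a b => Iff.trans ⟨fun h => ?_, ?_⟩ (hR a b)⟩
  · exact ⟨hq.lift a b h, hq.lift_fst .., hq.lift_snd ..⟩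
  · rintro ⟨l, rfl, rfl⟩
    simp [w]

end FilteredRelation

section FilteredColimit

variable [HasFiniteLimits D] {lam : Cardinal.{v'}} {K : Type v'} [SmallCategory K]
  {H : K ⥤ D} {t : Cocone H}

lemma ofArrows_ι_app_mem_canonicalTopology (hD : PretoposData D lam) (hK : Cardinal.mk K < lam)
    (ht : IsColimit t) : Sieve.ofArrows H.obj t.ι.app ∈ Sheaf.canonicalTopology D t.pt := by
  have := hD.hasCoprod _ hK H.obj
  obtain ⟨I, e, m, he, hm, hr⟩ := hD.factor (Sigma.desc t.ι.app)
  have hι (k : K) : Sigma.ι H.obj k ≫ e ≫ m = t.ι.app k := by simp [hr]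
  let s : t.pt ⟶ I := ht.desc ⟨I, ⟨fun k => Sigma.ι H.obj k ≫ e, fun k l u => by
    simp [← cancel_mono m, hι]⟩⟩
  have hs : s ≫ m = 𝟙 t.pt := ht.hom_ext fun k => by simp [s, hι]
  refine (Sheaf.canonicalTopology D).transitive
    ((Sheaf.canonicalTopology D).pullback_stable s
      (generateSingleton_mem_canonicalTopology hD.toCoherentData e he)) _ ?_
  rintro Y g ⟨a, ha⟩
  refine (Sheaf.canonicalTopology D).superset_covering ?_
    ((Sheaf.canonicalTopology D).pullback_stable a (ofArrows_inj_mem_canonicalTopology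
      (hD.coprod_pullback hK _ (coproductIsCoproduct H.obj))))
  intro W f hf
  obtain ⟨k, b, hb⟩ := (Sieve.mem_ofArrows_iff ..).1 hf
  refine (Sieve.mem_ofArrows_iff ..).2 ⟨k, b, ?_⟩
  calc f ≫ g = f ≫ g ≫ s ≫ m := by simp [hs]
    _ = f ≫ a ≫ e ≫ m := by rw [reassoc_of% ha]
    _ = b ≫ Sigma.ι H.obj k ≫ e ≫ m := (reassoc_of% hb) (e ≫ m)
    _ = b ≫ t.ι.app k := by rw [hι]

lemma exists_covering_of_comp_ι_app_eq [IsFiltered K] (hlam : Cardinal.aleph0 ≤ lam)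
    (hD : PretoposData D lam) (hK : Cardinal.mk (Arrow K) < lam) (ht : IsColimit t) {Z : D}
    {k l : K} (a : Z ⟶ H.obj k) (b : Z ⟶ H.obj l) (h : a ≫ t.ι.app k = b ≫ t.ι.app l) :
    ∃ S ∈ Sheaf.canonicalTopology D Z, ∀ ⦃Y : D⦄ (g : Y ⟶ Z), S g →
      ∃ (m : K) (u : k ⟶ m) (v : l ⟶ m), g ≫ a ≫ H.map u = g ≫ b ≫ H.map v := by
  have hK' := mk_lt_of_mk_arrow_lt hK
  have hlam' := Cardinal.aleph0_pos.trans_le hlam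
  have := hD.hasCoprod _ hK' H.obj
  let c : Cofan H.obj := Cofan.mk _ (Sigma.ι H.obj)
  have hc : IsColimit c := coproductIsCoproduct H.obj
  obtain ⟨Q, q, hq⟩ := exists_quotient hlam hD hK hc
  let d : t.pt ⟶ Q := ht.desc ⟨Q, ⟨fun k => c.inj k ≫ q, fun k l u => by
    have : (H.map u ≫ c.inj l) ≫ q = c.inj k ≫ q := by
      refine (hq _ _).2 ((Sheaf.canonicalTopology D).superset_covering ?_
        ((Sheaf.canonicalTopology D).top_mem _))
      rintro Y g -
      exact ⟨l, k, l, 𝟙 l, u, g ≫ H.map u, g, by simp, rfl, by simp⟩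
    simpa using this⟩⟩
  have hd (k : K) : t.ι.app k ≫ d = c.inj k ≫ q := ht.fac _ k
  have hab : (a ≫ c.inj k) ≫ q = (b ≫ c.inj l) ≫ q := by
    simp only [Category.assoc, ← hd, reassoc_of% h]
  let S : Sieve Z :=
    { arrows := fun Y g => ∃ (m : K) (u : k ⟶ m) (v : l ⟶ m),
        g ≫ a ≫ H.map u = g ≫ b ≫ H.map v
      downward_closed := by
        rintro Y Y' g ⟨m, u, v, e⟩ f
        exact ⟨m, u, v, by simp [e]⟩ }
  refine ⟨S, ?_, fun _ _ hg => hg⟩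
  refine (Sheaf.canonicalTopology D).transitive ((hq _ _).1 hab) _ ?_
  rintro Y g ⟨k', l', m, u, v, a', b', ha, hb, e⟩
  rw [← Category.assoc] at ha hb
  by_cases hk : k' = k
  · by_cases hl : l' = l
    · subst hk hl
      have := hD.coprod_mono hK' c ⟨hc⟩ k'
      have := hD.coprod_mono hK' c ⟨hc⟩ l'
      rw [cancel_mono] at ha hb
      subst ha hb
      refine (Sheaf.canonicalTopology D).superset_covering ?_
        ((Sheaf.canonicalTopology D).top_mem Y)
      rintro W f -
      exact ⟨m, u, v, by simpa using congrArg (f ≫ ·) e⟩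
    · exact (Sheaf.canonicalTopology D).superset_covering bot_le
        (bot_mem_canonicalTopology_of_inj_eq hlam' hD hK' hc hl hb)
  · exact (Sheaf.canonicalTopology D).superset_covering bot_le
      (bot_mem_canonicalTopology_of_inj_eq hlam' hD hK' hc hk ha)

end FilteredColimit

section Exactness

variable [HasFiniteLimits D] {lam : Cardinal.{v'}} {K : Type v'} [SmallCategory K] [IsFiltered K]

lemma preservesLimitsOfShape_of_sheaf (hlam : Cardinal.aleph0 ≤ lam) (hD : PretoposData D lam)
    (hK : Cardinal.mk (Arrow K) < lam) [HasColimitsOfShape K D]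
    (G : Sheaf (Sheaf.canonicalTopology D) (Type w)) : PreservesLimitsOfShape Kᵒᵖ G.obj where
  preservesLimit {H'} := by
    have hG := (isSheaf_iff_isSheaf_of_type _ _).1 G.property
    let H : K ⥤ D := H'.unop
    let t := colimit.cocone H
    have ht : IsColimit t := colimit.isColimit H
    refine preservesLimit_of_preserves_limit_cone (isLimitConeOfCoconeUnop _ ht)
      ((Types.isLimit_iff (G.obj.mapCone (coneOfCoconeUnop t))).2 ?_).some
    intro s hs
    have hS := (Presieve.isSheafFor_iff_generate _).2
      (hG _ (ofArrows_ι_app_mem_canonicalTopology hD (mk_lt_of_mk_arrow_lt hK) ht))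
    rw [Presieve.isSheafFor_arrows_iff] at hS
    let y (k : K) : G.obj.obj (Opposite.op (H.obj k)) := s (Opposite.op k)
    have hy {k l : K} (u : k ⟶ l) : G.obj.map (H.map u).op (y l) = y k := hs u.op
    obtain ⟨x, hx, hx'⟩ := hS y (by
      intro k l Z a b h
      obtain ⟨S, hS, h⟩ := exists_covering_of_comp_ι_app_eq hlam hD hK ht a b h
      refine (hG S hS).isSeparatedFor.ext fun Y g hg => ?_
      obtain ⟨m, u, v, e⟩ := h g hg
      rw [← hy u, ← hy v]
      simpa using congrArg (fun f => G.obj.map f.op (y m)) e)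
    exact ⟨x, fun k => hx k.unop, fun z hz => hx' z fun k => hz (Opposite.op k)⟩

/-- Filtered colimits of size `< λ` in a `λ`-pretopos commute with finite limits. -/
lemma hasExactColimitsOfShape (hlam : Cardinal.aleph0 ≤ lam) (hD : PretoposData D lam)
    (hK : Cardinal.mk (Arrow K) < lam) [HasColimitsOfShape K D] :
    HasExactColimitsOfShape K D := by
  have := preservesLimitsOfShape_of_sheaf.{max u' v'} hlam hD hK
  have : HasExactColimitsOfShape K (Type (max v' u')) := ⟨inferInstance⟩
  have : PreservesFiniteLimits ((Sheaf.canonicalTopology D).uliftYoneda.{u'}) :=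
    ⟨fun _ _ _ => inferInstance⟩
  have : ReflectsFiniteLimits ((Sheaf.canonicalTopology D).uliftYoneda.{u'}) :=
    ⟨fun _ _ _ => inferInstance⟩
  exact HasExactColimitsOfShape.domain_of_functor K
    ((Sheaf.canonicalTopology D).uliftYoneda.{u'})

end Exactness

lemma isIso_colimitLimitToLimitColimit {J : Type*} [Category* J] {K : Type*} [Category* K]
    [HasLimitsOfShape J C] [HasColimitsOfShape K C]
    [PreservesLimitsOfShape J (colim : (K ⥤ C) ⥤ C)] (F : J × K ⥤ C) :
    IsIso (colimitLimitToLimitColimit F) := by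
  obtain ⟨G, rfl⟩ : ∃ G : J ⥤ K ⥤ C, Functor.uncurry.obj G = F :=
    ⟨_, Functor.uncurry_obj_curry_obj F⟩
  let e := (isLimitOfPreserves colim (limit.isLimit G)).conePointUniqueUpToIso
    (limit.isLimit (G ⋙ colim))
  have h : colim.map (limitIsoSwapCompLim G).hom ≫ colimitLimitToLimitColimit _ ≫
      lim.map (Functor.whiskerRight (Functor.currying.unitIso.app G).inv colim) = e.hom :=
    (limit.isLimit (G ⋙ colim)).hom_ext fun j =>
      ((colimitLimitToLimitColimitCone G).w j).trans
        (IsLimit.conePointUniqueUpToIso_hom_comp _ _ j).symm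
  have h' : IsIso e.hom := inferInstance
  rw [← h, isIso_comp_left_iff, isIso_comp_right_iff] at h'
  exact h'

/-- In a `λ`-pretopos (`λ` a regular cardinal), filtered colimits of size `< λ`
commute with finite limits: for every filtered category `K` of size `< λ`,
every finite category `J` and every diagram `F : J × K ⥤ D`, the canonical
comparison map from the colimit over `K` of the limits over `J` to the limit
over `J` of the colimits over `K` is an isomorphism. -/
theorem pretopos_filtered_colimits_commute_finite_limits {D : Type u}
    [Category.{v} D] [HasFiniteLimits D]
    (lam : Cardinal.{v}) (hlam : lam.IsRegular) (hD : PretoposData D lam)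
    (J : Type v) [SmallCategory J] [FinCategory J]
    (K : Type v) [SmallCategory K] [IsFiltered K]
    (hK : Cardinal.mk (Arrow K) < lam)
    (F : J × K ⥤ D) [HasLimitsOfShape J D] [HasColimitsOfShape K D] :
    IsIso (colimitLimitToLimitColimit F) := by
  have := hasExactColimitsOfShape hlam.aleph0_le hD hK
  exact isIso_colimitLimitToLimitColimit F

end PosModel
end

section
/- Let C be a small coherent category, not equivalent to the terminal category, which is semantically complete. Then the coherent Set-valued models of C with elementary natural transformations have the joint embedding property: for any two coherent functors M, N : C ⥤ Type there exist a coherent functor P : C ⥤ Type and elementary natural transformations M ⟶ P and N ⟶ P. -/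
open CategoryTheory CategoryTheory.Limits

universe w v u v' u'

namespace PosModel

variable {C : Type u} [Category.{v} C] {D : Type u'} [Category.{v'} D]

/-! ### Subobjects in the category of types -/

theorem range_mk_arrow {X A : Type w} (f : A ⟶ X) [Mono f] :
    Set.range (Subobject.mk f).arrow = Set.range f := by
  apply Set.Subset.antisymm
  · rintro _ ⟨y, rfl⟩
    exact ⟨(Subobject.underlyingIso f).hom y, by
      rw [← comp_apply, Subobject.underlyingIso_hom_comp_eq_mk]⟩
  · rintro _ ⟨y, rfl⟩
    exact ⟨(Subobject.underlyingIso f).inv y, by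
      rw [← comp_apply, Subobject.underlyingIso_arrow]⟩

theorem subobject_le_iff {X : Type w} (S T : Subobject X) :
    S ≤ T ↔ Set.range S.arrow ⊆ Set.range T.arrow := by
  constructor
  · rintro h _ ⟨y, rfl⟩
    exact ⟨Subobject.ofLE S T h y, by rw [← comp_apply, Subobject.ofLE_arrow]⟩
  · intro h
    choose f hf using fun y => h ⟨y, rfl⟩
    exact Subobject.le_of_comm (TypeCat.ofHom f) (by ext y; exact hf y)

theorem subobject_eq_iff {X : Type w} (S T : Subobject X) :
    S = T ↔ Set.range S.arrow = Set.range T.arrow := by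
  rw [le_antisymm_iff, subobject_le_iff, subobject_le_iff, ← Set.Subset.antisymm_iff]

theorem exists_subobject_range {X : Type w} (s : Set X) :
    ∃ S : Subobject X, Set.range S.arrow = s := by
  have : Mono (TypeCat.ofHom (Subtype.val : s → X)) :=
    (mono_iff_injective _).2 Subtype.val_injective
  exact ⟨Subobject.mk (TypeCat.ofHom (Subtype.val : s → X)),
    (range_mk_arrow _).trans Subtype.range_val⟩

theorem range_sup_arrow (hT : CoherentData (Type w)) {X : Type w} (S T : Subobject X) :
    Set.range (hT.sup S T).arrow = Set.range S.arrow ∪ Set.range T.arrow := by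
  apply Set.Subset.antisymm
  · obtain ⟨R, hR⟩ := exists_subobject_range (Set.range S.arrow ∪ Set.range T.arrow)
    rw [← hR, ← subobject_le_iff]
    apply hT.sup_le <;> rw [subobject_le_iff, hR]
    exacts [Set.subset_union_left, Set.subset_union_right]
  · exact Set.union_subset ((subobject_le_iff _ _).1 (hT.le_sup_left S T))
      ((subobject_le_iff _ _).1 (hT.le_sup_right S T))

theorem range_bot_arrow (hT : CoherentData (Type w)) (X : Type w) :
    Set.range (hT.bot X).arrow = ∅ := by
  obtain ⟨R, hR⟩ := exists_subobject_range (∅ : Set X)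
  exact Set.subset_empty_iff.1 (hR ▸ (subobject_le_iff _ _).1 (hT.bot_le R))

theorem range_mapSub_arrow (F : C ⥤ Type w) (h : PreservesMono F) {X : C} (a : Subobject X) :
    Set.range (mapSub F h a).arrow = Set.range (F.map a.arrow) :=
  have := h a.arrow inferInstance
  range_mk_arrow (F.map a.arrow)

theorem mapSub_le_iff (F : C ⥤ Type w) (h : PreservesMono F) {X : C} (a b : Subobject X) :
    mapSub F h a ≤ mapSub F h b ↔ Set.range (F.map a.arrow) ⊆ Set.range (F.map b.arrow) := by
  rw [subobject_le_iff, range_mapSub_arrow, range_mapSub_arrow]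

theorem range_map_mk_arrow (F : C ⥤ Type w) {X A : C} (f : A ⟶ X) [Mono f] :
    Set.range (F.map (Subobject.mk f).arrow) = Set.range (F.map f) := by
  apply Set.Subset.antisymm
  · rintro _ ⟨y, rfl⟩
    exact ⟨F.map (Subobject.underlyingIso f).hom y, by
      rw [← comp_apply, ← F.map_comp, Subobject.underlyingIso_hom_comp_eq_mk]⟩
  · rintro _ ⟨y, rfl⟩
    exact ⟨F.map (Subobject.underlyingIso f).inv y, by
      rw [← comp_apply, ← F.map_comp, Subobject.underlyingIso_arrow]⟩

theorem mem_range_map_pullback_arrow [HasFiniteLimits C] (F : C ⥤ Type w)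
    [PreservesFiniteLimits F] {X Y : C} (f : X ⟶ Y) (b : Subobject Y) (q : F.obj X) :
    q ∈ Set.range (F.map ((Subobject.pullback f).obj b).arrow) ↔
      F.map f q ∈ Set.range (F.map b.arrow) := by
  have h := (Subobject.isPullback f b).map F
  constructor
  · rintro ⟨y, rfl⟩
    exact ⟨F.map (Subobject.pullbackπ f b) y, ConcreteCategory.congr_hom h.w y⟩
  · rintro ⟨y, hy⟩
    obtain ⟨z, -, hz⟩ := Types.exists_of_isPullback h y q hy
    exact ⟨z, hz⟩

theorem preservesMono_of_preservesFiniteLimits [HasFiniteLimits C] (F : C ⥤ D)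
    [PreservesFiniteLimits F] : PreservesMono F :=
  fun _ _ _ _ => inferInstance

section Coherent

variable [HasFiniteLimits C] {hC : CoherentData C} {hT : CoherentData (Type w)}

theorem IsCoherent.range_map_sup {F : C ⥤ Type w} (hF : IsCoherent hC hT F) {X : C}
    (a b : Subobject X) :
    Set.range (F.map (hC.sup a b).arrow) =
      Set.range (F.map a.arrow) ∪ Set.range (F.map b.arrow) := by
  rw [← range_mapSub_arrow F hF.presMono, hF.map_sup, range_sup_arrow, range_mapSub_arrow,
    range_mapSub_arrow]

theorem IsCoherent.range_map_bot {F : C ⥤ Type w} (hF : IsCoherent hC hT F) (X : C) :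
    Set.range (F.map (hC.bot X).arrow) = ∅ := by
  rw [← range_mapSub_arrow F hF.presMono, hF.map_bot, range_bot_arrow]

theorem IsCoherent.of_range_map {F : C ⥤ Type w} [PreservesFiniteLimits F]
    (epi : ∀ ⦃X Y : C⦄ (f : X ⟶ Y), EffectiveEpi f → EffectiveEpi (F.map f))
    (sup : ∀ {X : C} (a b : Subobject X), Set.range (F.map (hC.sup a b).arrow) =
      Set.range (F.map a.arrow) ∪ Set.range (F.map b.arrow))
    (bot : ∀ X : C, Set.range (F.map (hC.bot X).arrow) = ∅) : IsCoherent hC hT F where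
  presLim := ⟨inferInstance⟩
  presMono := preservesMono_of_preservesFiniteLimits F
  presEpi := epi
  map_sup a b := by
    rw [subobject_eq_iff, range_sup_arrow, range_mapSub_arrow, range_mapSub_arrow,
      range_mapSub_arrow, sup]
  map_bot X := by
    rw [subobject_eq_iff, range_bot_arrow, range_mapSub_arrow, bot]

end Coherent

theorem Elementary.of_mem_range {F G : C ⥤ Type w} (hF : PreservesMono F) (hG : PreservesMono G)
    (η : F ⟶ G)
    (h : ∀ ⦃a x : C⦄ (i : a ⟶ x), Mono i → ∀ p : F.obj x,
      η.app x p ∈ Set.range (G.map i) → p ∈ Set.range (F.map i)) :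
    Elementary η := by
  intro a x i hi
  rw [Types.isPullback_iff]
  refine ⟨η.naturality i, fun p q hpq => (mono_iff_injective _).1 (hF i hi) hpq.1, ?_⟩
  intro p r hr
  obtain ⟨q, rfl⟩ := h i hi p ⟨r, hr.symm⟩
  refine ⟨q, rfl, (mono_iff_injective _).1 (hG i hi) ?_⟩
  rw [← hr, NatTrans.naturality_apply]

/-! ### Ultrapowers -/

section Ultrapower

variable {I : Type w}

/-- The functor sending a type to its filter power. -/
def germFunctor (U : Filter I) : Type w ⥤ Type w where
  obj X := U.Germ X
  map f := TypeCat.ofHom (Filter.Germ.map f)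
  map_id X := by
    ext g
    induction g using Filter.Germ.inductionOn
    rfl
  map_comp f g := by
    ext x
    induction x using Filter.Germ.inductionOn
    rfl

theorem germFunctor_map_coe (U : Filter I) {X Y : Type w} (f : X ⟶ Y) (g : I → X) :
    (germFunctor U).map f (g : U.Germ X) = ((fun i => f (g i) : I → Y) : U.Germ Y) :=
  rfl

theorem coe_mem_range_germFunctor_map (U : Filter I) [U.NeBot] {X Y : Type w} (f : X ⟶ Y)
    (g : I → Y) :
    (g : U.Germ Y) ∈ Set.range ((germFunctor U).map f) ↔ ∀ᶠ i in U, g i ∈ Set.range f := by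
  constructor
  · rintro ⟨x, hx⟩
    induction x using Filter.Germ.inductionOn with | _ x => ?_
    rw [germFunctor_map_coe] at hx
    exact (Filter.Germ.coe_eq.1 hx).mono fun i hi => ⟨x i, hi⟩
  · intro h
    obtain ⟨i, y, -⟩ := h.exists
    classical
    refine ⟨((fun i => if hi : g i ∈ Set.range f then hi.choose else y : I → X) : U.Germ X), ?_⟩
    rw [germFunctor_map_coe]
    refine Filter.Germ.coe_eq.2 (h.mono fun i hi => ?_)
    simp only [dif_pos hi]
    exact hi.choose_spec

theorem germFunctor_map_isPullback (U : Filter I) [U.NeBot] {W X Y Z : Type w} {t : W ⟶ X}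
    {l : W ⟶ Y} {r : X ⟶ Z} {b : Y ⟶ Z} (h : IsPullback t l r b) :
    IsPullback ((germFunctor U).map t) ((germFunctor U).map l) ((germFunctor U).map r)
      ((germFunctor U).map b) := by
  rw [Types.isPullback_iff]
  refine ⟨by rw [← Functor.map_comp, h.w, Functor.map_comp], ?_, ?_⟩
  · intro p q
    refine Filter.Germ.inductionOn₂ p q fun p q => ?_
    rintro ⟨h₁, h₂⟩
    refine Filter.Germ.coe_eq.2 ?_
    filter_upwards [Filter.Germ.coe_eq.1 h₁, Filter.Germ.coe_eq.1 h₂] with i hi hi'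
    exact Types.ext_of_isPullback h hi hi'
  · intro p q
    refine Filter.Germ.inductionOn₂ p q fun p q => ?_
    intro hpq
    have H : ∀ᶠ i in U, ∃ x, t x = p i ∧ l x = q i :=
      (Filter.Germ.coe_eq.1 hpq).mono fun i hi => Types.exists_of_isPullback h _ _ hi
    obtain ⟨i, y, -⟩ := H.exists
    classical
    refine ⟨((fun i => if hi : ∃ x, t x = p i ∧ l x = q i then hi.choose else y : I → W) :
      U.Germ W), Filter.Germ.coe_eq.2 ?_, Filter.Germ.coe_eq.2 ?_⟩ <;>
    filter_upwards [H] with i hi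
    · simpa [dif_pos hi] using hi.choose_spec.1
    · simpa [dif_pos hi] using hi.choose_spec.2

instance (U : Filter I) [U.NeBot] : PreservesFiniteLimits (germFunctor U) := by
  have : PreservesLimit (Functor.empty.{0} (Type w)) (germFunctor U) := by
    refine preservesLimit_of_preserves_limit_cone
      (Types.isTerminalPUnit : IsTerminal (PUnit : Type w)) ?_
    refine (isLimitMapConeEmptyConeEquiv (germFunctor U) (PUnit : Type w)).symm ?_
    refine IsTerminal.ofUniqueHom
      (fun X => TypeCat.ofHom fun _ => ((fun _ => PUnit.unit : I → PUnit) : U.Germ PUnit)) ?_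
    have : Subsingleton (U.Germ (PUnit : Type w)) :=
      ⟨fun p q => Filter.Germ.inductionOn₂ p q fun _ _ =>
        Filter.Germ.coe_eq.2 (.of_forall fun _ => rfl)⟩
    intro X m
    ext x
    exact Subsingleton.elim (α := U.Germ PUnit) _ _
  have := preservesLimitsOfShape_pempty_of_preservesTerminal (germFunctor U)
  have : PreservesLimitsOfShape WalkingCospan (germFunctor U) := by
    refine ⟨fun {K} => ?_⟩
    have : PreservesLimit (cospan (K.map WalkingCospan.Hom.inl) (K.map WalkingCospan.Hom.inr))
        (germFunctor U) := by
      have h := IsPullback.of_hasPullback (K.map WalkingCospan.Hom.inl)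
        (K.map WalkingCospan.Hom.inr)
      exact preservesLimit_of_preserves_limit_cone h.isLimit
        ((isLimitMapConePullbackConeEquiv _ h.w).symm (germFunctor_map_isPullback U h).isLimit)
    exact preservesLimit_of_iso_diagram _ (diagramIsoCospan K).symm
  exact preservesFiniteLimits_of_preservesTerminal_and_pullbacks _

theorem IsCoherent.comp_germFunctor [HasFiniteLimits C] {hC : CoherentData C}
    {hT : CoherentData (Type w)} {F : C ⥤ Type w} (hF : IsCoherent hC hT F) (U : Ultrafilter I) :
    IsCoherent hC hT (F ⋙ germFunctor (U : Filter I)) := by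
  have := hF.presLim.some
  refine IsCoherent.of_range_map ?_ ?_ ?_
  · intro X Y f hf
    have := hF.presEpi f hf
    have : IsSplitEpi (F.map f) := isSplitEpi_of_epi _
    exact inferInstanceAs (EffectiveEpi ((germFunctor (U : Filter I)).map (F.map f)))
  · intro X a b
    ext g
    induction g using Filter.Germ.inductionOn with | _ g => ?_
    refine (coe_mem_range_germFunctor_map (U : Filter I) _ g).trans ?_
    rw [hF.range_map_sup]
    exact Ultrafilter.eventually_or.trans (or_congr
      (coe_mem_range_germFunctor_map (U : Filter I) _ g).symm
      (coe_mem_range_germFunctor_map (U : Filter I) _ g).symm)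
  · intro X
    refine Set.eq_empty_of_forall_notMem fun g => ?_
    induction g using Filter.Germ.inductionOn with | _ g => ?_
    intro hg
    obtain ⟨i, hi⟩ := ((coe_mem_range_germFunctor_map (U : Filter I) _ g).1 hg).exists
    rwa [hF.range_map_bot] at hi

/-- The diagonal embedding of a functor in its filter power. -/
def diagonal (F : C ⥤ Type w) (U : Filter I) : F ⟶ F ⋙ germFunctor U where
  app X := TypeCat.ofHom fun p => ((fun _ => p : I → F.obj X) : U.Germ (F.obj X))
  naturality _ _ _ := rfl

theorem elementary_diagonal [HasFiniteLimits C] (F : C ⥤ Type w) [PreservesFiniteLimits F]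
    (U : Filter I) [U.NeBot] : Elementary (diagonal F U) := by
  refine Elementary.of_mem_range (preservesMono_of_preservesFiniteLimits _)
    (preservesMono_of_preservesFiniteLimits _) _ ?_
  intro a x i _ p hp
  exact ((coe_mem_range_germFunctor_map U (F.map i) fun _ => p).1 hp).exists.choose_spec

end Ultrapower

/-! ### Embedding a functor in an ultrapower of an elementarily equivalent one -/

section Embedding

variable [HasFiniteLimits C] {hC : CoherentData C} {hT : CoherentData (Type w)}
  {M N : C ⥤ Type w}

theorem exists_subobject_avoiding (hM : IsCoherent hC hT M) {X : C} (p : M.obj X)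
    (s : Finset (Subobject X)) (hs : ∀ b ∈ s, p ∉ Set.range (M.map b.arrow)) :
    ∃ c : Subobject X, p ∉ Set.range (M.map c.arrow) ∧ ∀ b ∈ s, b ≤ c := by
  classical
  induction s using Finset.induction with
  | empty => exact ⟨hC.bot X, by simp [hM.range_map_bot], by simp⟩
  | insert b s _ ih =>
    obtain ⟨c, hc, hbc⟩ := ih fun b hb => hs b (Finset.mem_insert_of_mem hb)
    refine ⟨hC.sup b c, ?_, ?_⟩
    · rw [hM.range_map_sup]
      rintro (h | h)
      exacts [hs b (Finset.mem_insert_self b s) h, hc h]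
    · intro d hd
      rcases Finset.mem_insert.1 hd with rfl | hd
      exacts [hC.le_sup_left d c, (hbc d hd).trans (hC.le_sup_right b c)]

theorem exists_notMem_of_elemEquiv (hM : PreservesMono M) (hN : PreservesMono N)
    (h : ElemEquiv M N hM hN) {X : C} (p : M.obj X) (s : Subobject X)
    (hp : p ∉ Set.range (M.map s.arrow)) : ∃ q : N.obj X, q ∉ Set.range (N.map s.arrow) := by
  by_contra! hq
  have H := (mapSub_le_iff M hM ⊤ s).1
    ((h X ⊤ s).2 ((mapSub_le_iff N hN ⊤ s).2 fun q _ => hq q))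
  refine hp (H ⟨M.map (inv (⊤ : Subobject X).arrow) p, ?_⟩)
  rw [← comp_apply, ← M.map_comp, IsIso.inv_hom_id, M.map_id, id_apply]

/-- The atomic conditions on a family of maps from `M` to an ultrapower of `N`: compatibility with
a morphism of elements, and not entering a subobject avoided by a given element. -/
def Condition (M : C ⥤ Type w) :=
  (Σ e e' : M.Elements, e ⟶ e') ⊕
    (Σ e : M.Elements, { b : Subobject e.1 // e.2 ∉ Set.range (M.map b.arrow) })

/-- The families of elements of `N` satisfying a condition. -/
def Condition.solutions (N : C ⥤ Type w) : Condition M → Set (∀ e : M.Elements, N.obj e.1)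
  | .inl ⟨e, e', g⟩ => { f | N.map g.1 (f e) = f e' }
  | .inr ⟨e, b⟩ => { f | f e ∉ Set.range (N.map b.1.arrow) }

/-- The elements of `M` mentioned in a condition. -/
def Condition.support [DecidableEq M.Elements] : Condition M → Finset M.Elements
  | .inl ⟨e, e', _⟩ => {e, e'}
  | .inr ⟨e, _⟩ => {e}

theorem exists_solution (hM : IsCoherent hC hT M) (hN : IsCoherent hC hT N)
    (h : ElemEquiv M N hM.presMono hN.presMono) (s : Finset (Condition M)) :
    ∃ f : ∀ e : M.Elements, N.obj e.1, ∀ k ∈ s, f ∈ k.solutions N := by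
  classical
  have := hM.presLim.some
  have := hN.presLim.some
  have := M.isCofiltered_elements
  have nonempty (e : M.Elements) : Nonempty (N.obj e.1) :=
    (exists_notMem_of_elemEquiv hM.presMono hN.presMono h e.2 (hC.bot e.1)
      (by simp [hM.range_map_bot])).nonempty
  let O : Finset M.Elements := s.biUnion Condition.support
  have hO {k} (hk : k ∈ s) {e} (he : e ∈ k.support) : e ∈ O :=
    Finset.mem_biUnion.2 ⟨k, hk, he⟩
  let H : Finset (Σ' (X Y : M.Elements) (_ : X ∈ O) (_ : Y ∈ O), X ⟶ Y) :=
    s.attach.biUnion fun k => match k with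
      | ⟨.inl ⟨e, e', g⟩, hk⟩ => {⟨e, e', hO hk (by simp [Condition.support]),
          hO hk (by simp [Condition.support]), g⟩}
      | ⟨.inr _, _⟩ => ∅
  obtain ⟨S, T, hST⟩ := IsCofiltered.inf_exists O H
  let B : Finset (Subobject S.1) := s.attach.biUnion fun k => match k with
      | ⟨.inl _, _⟩ => ∅
      | ⟨.inr ⟨e, b⟩, hk⟩ =>
        {(Subobject.pullback (T (hO hk (by simp [Condition.support]) : e ∈ O)).1).obj b.1}
  obtain ⟨c, hc, hBc⟩ := exists_subobject_avoiding hM S.2 B (by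
    intro b hb
    obtain ⟨⟨k | ⟨e, b'⟩, hk⟩, -, hb⟩ := Finset.mem_biUnion.1 hb
    · simp at hb
    · rw [Finset.mem_singleton] at hb
      rw [hb, mem_range_map_pullback_arrow, (T _).2]
      exact b'.2)
  obtain ⟨q, hq⟩ := exists_notMem_of_elemEquiv hM.presMono hN.presMono h S.2 c hc
  refine ⟨fun e => if he : e ∈ O then N.map (T he).1 q else (nonempty e).some, ?_⟩
  rintro (⟨e, e', g⟩ | ⟨e, b⟩) hk
  · have he : e ∈ O := hO hk (by simp [Condition.support])
    have he' : e' ∈ O := hO hk (by simp [Condition.support])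
    have hg := hST he he' (f := g) (Finset.mem_biUnion.2 ⟨⟨_, hk⟩, Finset.mem_attach _ _,
      Finset.mem_singleton_self _⟩)
    simp only [Condition.solutions, Set.mem_ofPred_eq, dif_pos he, dif_pos he']
    rw [← comp_apply, ← N.map_comp, ← hg]
    rfl
  · have he : e ∈ O := hO hk (by simp [Condition.support])
    simp only [Condition.solutions, Set.mem_ofPred_eq, dif_pos he]
    rw [← mem_range_map_pullback_arrow]
    have hle := hBc ((Subobject.pullback (T he).1).obj b.1) (Finset.mem_biUnion.2
      ⟨⟨_, hk⟩, Finset.mem_attach _ _, Finset.mem_singleton_self _⟩)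
    rintro ⟨y, rfl⟩
    refine hq ⟨N.map (Subobject.ofLE _ _ hle) y, ?_⟩
    rw [← comp_apply, ← N.map_comp, Subobject.ofLE_arrow]

theorem exists_ultrafilter_solutions (hM : IsCoherent hC hT M) (hN : IsCoherent hC hT N)
    (h : ElemEquiv M N hM.presMono hN.presMono) :
    ∃ U : Ultrafilter (∀ e : M.Elements, N.obj e.1), ∀ k : Condition M, k.solutions N ∈ U := by
  classical
  obtain ⟨U, hU⟩ := Ultrafilter.exists_ultrafilter_of_finite_inter_nonempty
    (Set.range fun k : Condition M => k.solutions N) (by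
      intro t ht
      rw [← Set.image_univ] at ht
      obtain ⟨s, -, rfl⟩ := Finset.subset_set_image_iff.1 ht
      obtain ⟨f, hf⟩ := exists_solution hM hN h s
      refine ⟨f, ?_⟩
      simpa using hf)
  exact ⟨U, fun k => hU ⟨k, rfl⟩⟩

end Embedding

/-- Evaluation of families at the elements of `M`, as a natural transformation to a power of `N`
modulo a filter concentrated on the compatible families. -/
def evalGerm {C : Type w} [SmallCategory C] {M N : C ⥤ Type w}
    (U : Filter (∀ e : M.Elements, N.obj e.1))
    (hU : ∀ k : Condition M, k.solutions N ∈ U) : M ⟶ N ⋙ germFunctor U where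
  app X := TypeCat.ofHom fun p =>
    ((fun f => f ⟨X, p⟩ : (∀ e : M.Elements, N.obj e.1) → N.obj X) : U.Germ (N.obj X))
  naturality X Y g := by
    ext p
    refine Filter.Germ.coe_eq.2 ?_
    filter_upwards [hU (.inl ⟨⟨X, p⟩, ⟨Y, M.map g p⟩, ⟨g, rfl⟩⟩)] with f hf
    exact hf.symm

theorem elementary_evalGerm {C : Type w} [SmallCategory C] [HasFiniteLimits C]
    {M N : C ⥤ Type w} [PreservesFiniteLimits M] [PreservesFiniteLimits N]
    (U : Filter (∀ e : M.Elements, N.obj e.1)) [U.NeBot]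
    (hU : ∀ k : Condition M, k.solutions N ∈ U) : Elementary (evalGerm U hU) := by
  refine Elementary.of_mem_range (preservesMono_of_preservesFiniteLimits _)
    (preservesMono_of_preservesFiniteLimits _) _ ?_
  intro a x i _ p hp
  have hp' := (coe_mem_range_germFunctor_map U (N.map i) fun f => f ⟨x, p⟩).1 hp
  by_contra hpi
  rw [← range_map_mk_arrow] at hpi
  obtain ⟨f, hf, hf'⟩ := (hp'.and (hU (.inr ⟨⟨x, p⟩, ⟨Subobject.mk i, hpi⟩⟩))).exists
  rw [← range_map_mk_arrow] at hf
  exact hf' hf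

/-- If a small coherent category `C`, not equivalent to the terminal category,
is semantically complete (any two `Set`-valued coherent functors are
elementarily equivalent), then its category of `Set`-valued models with
elementary natural transformations has the joint embedding property. -/
theorem jep_of_semanticallyComplete (C : Type v) [SmallCategory C] [HasFiniteLimits C]
    (hC : CoherentData C) (hT : CoherentData (Type v))
    (hnt : ¬ Nonempty (C ≌ Discrete PUnit.{v + 1}))
    -- semantic completeness
    (hsc : ∀ (M N : C ⥤ Type v) (hM : IsCoherent hC hT M) (hN : IsCoherent hC hT N),
      ElemEquiv M N hM.presMono hN.presMono)
    (M N : C ⥤ Type v) (hM : IsCoherent hC hT M) (hN : IsCoherent hC hT N) :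
    ∃ (P : C ⥤ Type v) (_ : IsCoherent hC hT P) (α : M ⟶ P) (β : N ⟶ P),
      Elementary α ∧ Elementary β := by
  obtain ⟨U, hU⟩ := exists_ultrafilter_solutions hM hN (hsc M N hM hN)
  have := hM.presLim.some
  have := hN.presLim.some
  exact ⟨N ⋙ germFunctor U.toFilter, hN.comp_germFunctor U, evalGerm U.toFilter hU,
    diagonal N U.toFilter, elementary_evalGerm U.toFilter hU, elementary_diagonal N U.toFilter⟩

end PosModel
end
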